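/- Let f be a transcendental self-map of ℂ*. Then the set I(f) ∪ {0,∞}, regarded as a subset of the Riemann sphere ℂ̂ = ℂ ∪ {∞}, is either connected or it has exactly two connected components, one containing 0 and the other containing ∞. -/

import Mathlib

open Complex Topology Filter Set Function OnePoint

noncomputable section

/-- The chordal (spherical) distance on the Riemann sphere, restricted to finite points. -/
def chordalDist (z w : ℂ) : ℝ :=
  ‖z - w‖ / Real.sqrt ((1 + ‖z‖ ^ 2) * (1 + ‖w‖ ^ 2))

/-- A transcendental self-map of `ℂ* = ℂ \ {0}`: a holomorphic self-map of the punctured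
plane with essential singularities at `0` and `∞`; equivalently, on `ℂ*` it has the form
`z ^ m * exp (g z + h z⁻¹)` for some `m : ℤ` and nonconstant entire functions `g, h`. -/
def IsTranscendentalSelfMapCStar (f : ℂ → ℂ) : Prop :=
  ∃ (m : ℤ) (g h : ℂ → ℂ),
    Differentiable ℂ g ∧ Differentiable ℂ h ∧
    (¬ ∃ c : ℂ, ∀ z, g z = c) ∧ (¬ ∃ c : ℂ, ∀ z, h z = c) ∧
    ∀ z : ℂ, z ≠ 0 → f z = z ^ m * Complex.exp (g z + h z⁻¹)

/-- The escaping set `I(f)` of a self-map of the punctured plane: points whose orbit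
accumulates only at `0` and `∞`. -/
def escapingSet (f : ℂ → ℂ) : Set ℂ :=
  {z | z ≠ 0 ∧ ∀ ε : ℝ, 0 < ε → ∃ N : ℕ, ∀ n ≥ N,
    ‖f^[n] z‖ < ε ∨ 1 / ε < ‖f^[n] z‖}

/-- The little escaping set `I_e(f)` with essential itinerary `e` (where `true` stands for the
symbol `∞` and `false` for the symbol `0`). -/
def littleEscapingSet (f : ℂ → ℂ) (e : ℕ → Bool) : Set ℂ :=
  {z | z ∈ escapingSet f ∧ ∃ ℓ k : ℕ, ∀ n : ℕ,
    (1 < ‖f^[n + ℓ] z‖ ↔ e (n + k) = true)}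

/-- The immediate little escaping set `Ĩ_e(f)`. -/
def immediateLittleEscapingSet (f : ℂ → ℂ) (e : ℕ → Bool) : Set ℂ :=
  {z | z ∈ escapingSet f ∧ ∃ ℓ : ℕ, ∀ n : ℕ,
    (1 < ‖f^[n + ℓ] z‖ ↔ e (n + ℓ) = true)}

/-- The Fatou set of a self-map of the punctured plane: points of `ℂ*` with a neighbourhood
(inside `ℂ*`) on which the family of iterates is equicontinuous w.r.t. the chordal metric. -/
def FatouSet (f : ℂ → ℂ) : Set ℂ :=
  {z | z ≠ 0 ∧ ∃ U : Set ℂ, IsOpen U ∧ z ∈ U ∧ (∀ w ∈ U, w ≠ 0) ∧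
    ∀ w ∈ U, ∀ ε : ℝ, 0 < ε → ∃ δ : ℝ, 0 < δ ∧ ∀ w' ∈ U,
      chordalDist w w' < δ → ∀ n : ℕ, chordalDist (f^[n] w) (f^[n] w') < ε}

/-- The Julia set `J(f) = ℂ* \ F(f)`. -/
def JuliaSet (f : ℂ → ℂ) : Set ℂ := {z : ℂ | z ≠ 0} \ FatouSet f

/-- A Fatou component: a connected component of the Fatou set. -/
def IsFatouComponent (f : ℂ → ℂ) (U : Set ℂ) : Prop :=
  ∃ z ∈ FatouSet f, U = connectedComponentIn (FatouSet f) z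

/-- A wandering domain: a Fatou component `U` such that the Fatou components containing the
iterated images `fⁿ(U)` are pairwise distinct. -/
def IsWanderingDomain (f : ℂ → ℂ) (U : Set ℂ) : Prop :=
  IsFatouComponent f U ∧ ∃ V : ℕ → Set ℂ, V 0 = U ∧
    (∀ n, IsFatouComponent f (V n)) ∧
    (∀ n, f '' V n ⊆ V (n + 1)) ∧ Function.Injective V

/-- A set is bounded in `ℂ*` if it lies in some closed annulus `{r ≤ |z| ≤ R}`. -/
def BoundedInCStar (X : Set ℂ) : Prop :=
  ∃ r R : ℝ, 0 < r ∧ r ≤ R ∧ X ⊆ {z : ℂ | r ≤ ‖z‖ ∧ ‖z‖ ≤ R}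

/-- The boundary of a subset of `ℂ*` taken in `ℂ*`. -/
def boundaryInCStar (G : Set ℂ) : Set ℂ := frontier G \ {0}

/-- The set `I(f) ∪ {0, ∞}` regarded as a subset of the Riemann sphere `ℂ̂ = ℂ ∪ {∞}`. -/
def escapingSphere (f : ℂ → ℂ) : Set (OnePoint ℂ) :=
  ((fun z : ℂ => (z : OnePoint ℂ)) '' escapingSet f) ∪ {((0 : ℂ) : OnePoint ℂ), ∞}

/-- The set `I_e(f) ∪ {0, ∞}` regarded as a subset of the Riemann sphere. -/
def littleEscapingSphere (f : ℂ → ℂ) (e : ℕ → Bool) : Set (OnePoint ℂ) :=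
  ((fun z : ℂ => (z : OnePoint ℂ)) '' littleEscapingSet f e) ∪ {((0 : ℂ) : OnePoint ℂ), ∞}

/-- A subset of the sphere has exactly two connected components. -/
def HasExactlyTwoComponents (K : Set (OnePoint ℂ)) : Prop :=
  ∃ x ∈ K, ∃ y ∈ K, connectedComponentIn K x ≠ connectedComponentIn K y ∧
    ∀ z ∈ K, connectedComponentIn K z = connectedComponentIn K x ∨
      connectedComponentIn K z = connectedComponentIn K y

/-- A domain `U ⊆ ℂ*` is doubly connected if its complement in the Riemann sphere has
exactly two connected components. -/
def DoublyConnected (U : Set ℂ) : Prop :=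
  HasExactlyTwoComponents (((fun z : ℂ => (z : OnePoint ℂ)) '' U)ᶜ)

/-- A transcendental entire function. -/
def IsTranscendentalEntire (f : ℂ → ℂ) : Prop :=
  Differentiable ℂ f ∧ ¬ ∃ p : Polynomial ℂ, ∀ z, f z = p.eval z

/-- The Fatou set of an entire function. -/
def FatouSetEntire (f : ℂ → ℂ) : Set ℂ :=
  {z | ∃ U : Set ℂ, IsOpen U ∧ z ∈ U ∧
    ∀ w ∈ U, ∀ ε : ℝ, 0 < ε → ∃ δ : ℝ, 0 < δ ∧ ∀ w' ∈ U,
      chordalDist w w' < δ → ∀ n : ℕ, chordalDist (f^[n] w) (f^[n] w') < ε}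

/-- The Julia set of an entire function. -/
def JuliaSetEntire (f : ℂ → ℂ) : Set ℂ := (FatouSetEntire f)ᶜ

/-- `f` has a finite asymptotic value. -/
def HasFiniteAsymptoticValue (f : ℂ → ℂ) : Prop :=
  ∃ (a : ℂ) (γ : ℝ → ℂ), ContinuousOn γ (Set.Ici (0 : ℝ)) ∧
    Tendsto (fun t => ‖γ t‖) atTop atTop ∧
    Tendsto (fun t => f (γ t)) atTop (nhds a)

open Metric in
/-- A nonvanishing holomorphic function on a disc has a holomorphic logarithm, normalised
by the principal branch at the centre. -/
lemma exists_log_on_ball {q : ℂ → ℂ} {c : ℂ} {R : ℝ} (hR : 0 < R)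
    (hq : DifferentiableOn ℂ q (ball c R)) (h0 : ∀ z ∈ ball c R, q z ≠ 0) :
    ∃ φ : ℂ → ℂ, DifferentiableOn ℂ φ (ball c R) ∧ φ c = Complex.log (q c) ∧
      ∀ z ∈ ball c R, Complex.exp (φ z) = q z := by
  have hd : DifferentiableOn ℂ (fun z => deriv q z / q z) (ball c R) :=
    (hq.deriv isOpen_ball).div hq h0
  obtain ⟨φ, hφc, hφ⟩ := hd.isExactOn_ball.with_val_at c (Complex.log (q c))
  have hφd : DifferentiableOn ℂ φ (ball c R) :=
    fun z hz => (hφ z hz).differentiableAt.differentiableWithinAt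
  refine ⟨φ, hφd, hφc, fun z hz => ?_⟩
  have hcm : c ∈ ball c R := mem_ball_self hR
  have key : ∀ w ∈ ball c R, HasDerivAt (fun w => q w * Complex.exp (-φ w)) 0 w := by
    intro w hw
    have h1 := (hq.differentiableAt (isOpen_ball.mem_nhds hw)).hasDerivAt
    have h2 := (hφ w hw).neg.cexp
    have h3 : q w * (deriv q w / q w) = deriv q w := mul_div_cancel₀ _ (h0 w hw)
    have h4 : deriv q w * Complex.exp (-φ w) +
        q w * (Complex.exp (-φ w) * -(deriv q w / q w)) = 0 := by
      linear_combination -Complex.exp (-φ w) * h3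
    exact h4 ▸ h1.mul h2
  have hconst : q z * Complex.exp (-φ z) = q c * Complex.exp (-φ c) := by
    refine isOpen_ball.is_const_of_deriv_eq_zero (convex_ball c R).isPreconnected
      (f := fun w => q w * Complex.exp (-φ w))
      (fun w hw => (key w hw).differentiableAt.differentiableWithinAt)
      (fun w hw => (key w hw).deriv) hz hcm
  rw [hφc, Complex.exp_neg, Complex.exp_neg, Complex.exp_log (h0 c hcm),
    mul_inv_cancel₀ (h0 c hcm)] at hconst
  rw [← div_eq_mul_inv, div_eq_one_iff_eq (Complex.exp_ne_zero _)] at hconst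
  exact hconst.symm

open Metric in
/-- A holomorphic function whose derivative is controlled by its value at the centre covers a
disc of definite size around the image of the centre. -/
lemma ball_subset_image_of_norm_deriv_le {F : ℂ → ℂ} {a : ℂ} {t : ℝ} (ht : 0 < t)
    (hF : DifferentiableOn ℂ F (ball a t)) (h0 : deriv F a ≠ 0)
    (hb : ∀ z ∈ ball a t, ‖deriv F z‖ ≤ 2 * ‖deriv F a‖) :
    ball (F a) (t * ‖deriv F a‖ / 32) ⊆ F '' ball a t := by
  set A := ‖deriv F a‖ with hA
  have hApos : 0 < A := norm_pos_iff.2 h0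
  have hF' : DifferentiableOn ℂ (deriv F) (ball a t) := hF.deriv isOpen_ball
  have hsch : ∀ z ∈ ball a t, ‖deriv F z - deriv F a‖ ≤ 3 * A / t * ‖z - a‖ := by
    intro z hz
    have := Complex.dist_le_div_mul_dist_of_mapsTo_ball (R₂ := 3 * A) hF' (fun w hw => by
      rw [mem_closedBall, dist_eq_norm]
      calc _ ≤ ‖deriv F w‖ + ‖deriv F a‖ := norm_sub_le _ _
        _ ≤ _ := by linarith [hb w hw]) hz
    simpa [dist_eq_norm] using this
  have hsub : closedBall a (t / 4) ⊆ ball a t := closedBall_subset_ball (by linarith)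
  have hcomp : ∀ z ∈ sphere a (t / 4), t * A / 16 ≤ ‖F z - F a‖ := by
    intro z hz
    have hz' : ‖z - a‖ = t / 4 := by simpa [dist_eq_norm] using hz
    have hmv : ‖(F z - deriv F a * z) - (F a - deriv F a * a)‖ ≤ 3 * A / 4 * ‖z - a‖ := by
      refine (convex_closedBall a (t / 4)).norm_image_sub_le_of_norm_hasDerivWithin_le
        (f := fun z => F z - deriv F a * z) (f' := fun z => deriv F z - deriv F a)
        ?_ ?_ (mem_closedBall_self (by linarith)) (sphere_subset_closedBall hz)
      · intro w hw
        have h1 := (hF.differentiableAt (isOpen_ball.mem_nhds (hsub hw))).hasDerivAt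
        have h2 := (hasDerivAt_id w).const_mul (deriv F a)
        have := h1.sub h2
        simp only [mul_one] at this
        exact this.hasDerivWithinAt
      · intro w hw
        refine (hsch w (hsub hw)).trans ?_
        have : ‖w - a‖ ≤ t / 4 := by simpa [dist_eq_norm] using hw
        calc 3 * A / t * ‖w - a‖ ≤ 3 * A / t * (t / 4) := by gcongr
          _ = 3 * A / 4 := by field_simp
    have h3 : ‖deriv F a * (z - a)‖ ≤
        ‖F z - F a‖ + ‖(F z - deriv F a * z) - (F a - deriv F a * a)‖ := by
      have : deriv F a * (z - a) =
          (F z - F a) - ((F z - deriv F a * z) - (F a - deriv F a * a)) := by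
        ring
      rw [this]; exact norm_sub_le _ _
    rw [norm_mul, hz', ← hA] at h3
    rw [hz'] at hmv
    linarith
  have hd : DiffContOnCl ℂ F (ball a (t / 4)) :=
    (hF.mono (by rw [closure_ball _ (by positivity)]; exact hsub)).diffContOnCl
  have hfreq : ∃ᶠ z in 𝓝 a, F z ≠ F a := by
    intro hev
    simp only [not_not] at hev
    have : deriv F a = 0 := by
      rw [Filter.EventuallyEq.deriv_eq (f := fun _ => F a) hev]; simp
    exact h0 this
  have := hd.ball_subset_image_closedBall (by linarith) hcomp hfreq
  intro w hw
  have hw' : w ∈ ball (F a) (t * A / 16 / 2) := by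
    convert hw using 2; ring
  exact image_mono hsub (this hw')

open Metric in
/-- A form of Bloch's theorem: if the image of a disc contains no disc of radius `b`, then the
derivative at the centre is bounded. -/
lemma norm_deriv_le_of_forall_not_ball_subset {F : ℂ → ℂ} {c : ℂ} {R b : ℝ} (hR : 0 < R)
    (hF : DifferentiableOn ℂ F (ball c R))
    (hb : ∀ w, ¬ ball w b ⊆ F '' ball c R) : ‖deriv F c‖ ≤ 128 * b / R := by
  have hF' : DifferentiableOn ℂ (deriv F) (ball c R) := hF.deriv isOpen_ball
  have hsub : closedBall c (R / 2) ⊆ ball c R := closedBall_subset_ball (by linarith)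
  have hcont : ContinuousOn (fun z => (R / 2 - ‖z - c‖) * ‖deriv F z‖) (closedBall c (R / 2)) :=
    (by fun_prop : ContinuousOn (fun z => (R / 2 - ‖z - c‖)) (closedBall c (R / 2))).mul
      (hF'.continuousOn.mono hsub).norm
  obtain ⟨a, ha, hmax⟩ := (isCompact_closedBall c (R / 2)).exists_isMaxOn
    ⟨c, mem_closedBall_self (by linarith)⟩ hcont
  set M := (R / 2 - ‖a - c‖) * ‖deriv F a‖ with hM
  have hMc : R / 2 * ‖deriv F c‖ ≤ M := by
    have := hmax (mem_closedBall_self (by linarith) : c ∈ closedBall c (R / 2))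
    simpa using this
  have hac : ‖a - c‖ ≤ R / 2 := by simpa [dist_eq_norm] using ha
  have hMb : M ≤ 64 * b := by
    by_contra hcon
    push Not at hcon
    have hb0 : 0 < b := by
      by_contra hb0
      exact hb 0 (by rw [ball_eq_empty.2 (by linarith)]; exact empty_subset _)
    have hMpos : 0 < M := by linarith
    have hne : deriv F a ≠ 0 := by
      intro h; rw [h] at hM; simp at hM; linarith
    have hpos : 0 < R / 2 - ‖a - c‖ := by
      by_contra h
      have : M ≤ 0 := mul_nonpos_of_nonpos_of_nonneg (by linarith) (norm_nonneg _)
      linarith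
    set t := (R / 2 - ‖a - c‖) / 2 with ht
    have htpos : 0 < t := by positivity
    have hballs : ∀ z ∈ ball a t, t ≤ R / 2 - ‖z - c‖ := by
      intro z hz
      have h1 : ‖z - a‖ < t := by simpa [dist_eq_norm] using hz
      have h2 : ‖z - c‖ ≤ ‖z - a‖ + ‖a - c‖ := by
        have := norm_add_le (z - a) (a - c); simpa using this
      linarith
    have hsub2 : ball a t ⊆ closedBall c (R / 2) := by
      intro z hz
      rw [mem_closedBall, dist_eq_norm]
      linarith [hballs z hz]
    have key := ball_subset_image_of_norm_deriv_le htpos (hF.mono (hsub2.trans hsub)) hne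
      (fun z hz => by
        have h1 := hmax (hsub2 hz)
        simp only [mem_ofPred_eq] at h1
        have h2 : t * ‖deriv F z‖ ≤ M :=
          (mul_le_mul_of_nonneg_right (hballs z hz) (norm_nonneg _)).trans h1
        have h3 : M = t * (2 * ‖deriv F a‖) := by rw [hM, ht]; ring
        rw [h3] at h2
        exact le_of_mul_le_mul_left h2 htpos)
    refine hb (F a) ((ball_subset_ball ?_).trans (key.trans (image_mono (hsub2.trans hsub))))
    have : M = 2 * (t * ‖deriv F a‖) := by rw [hM, ht]; ring
    linarith
  rw [le_div_iff₀ hR]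
  linarith

open Metric in
lemma norm_sub_le_of_forall_not_ball_subset {F : ℂ → ℂ} {c : ℂ} {R b : ℝ} (hR : 0 < R)
    (hF : DifferentiableOn ℂ F (ball c R))
    (hb : ∀ w, ¬ ball w b ⊆ F '' ball c R) {z : ℂ} (hz : z ∈ closedBall c (R / 2)) :
    ‖F z - F c‖ ≤ 128 * b := by
  have hd : ∀ w ∈ closedBall c (R / 2), ball w (R / 2) ⊆ ball c R := by
    intro w hw
    refine ball_subset_ball' ?_
    have := mem_closedBall.1 hw
    linarith
  have hmv := (convex_closedBall c (R / 2)).norm_image_sub_le_of_norm_hasDerivWithin_le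
        (f := F) (f' := deriv F) (C := 128 * b / (R / 2)) (fun w hw =>
          (hF.differentiableAt (isOpen_ball.mem_nhds
            (hd w hw (mem_ball_self (by linarith))))).hasDerivAt.hasDerivWithinAt)
        (fun w hw => norm_deriv_le_of_forall_not_ball_subset (by linarith)
          (hF.mono (hd w hw)) (fun v hv => hb v (hv.trans (image_mono (hd w hw)))))
        (mem_closedBall_self (by linarith)) hz
  have hb0 : 0 ≤ b := by
    by_contra h
    exact hb 0 (by rw [ball_eq_empty.2 (by linarith)]; exact empty_subset _)
  have hz' : ‖z - c‖ ≤ R / 2 := by simpa [dist_eq_norm] using hz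
  calc _ ≤ 128 * b / (R / 2) * ‖z - c‖ := hmv
    _ ≤ 128 * b / (R / 2) * (R / 2) := by gcongr
    _ = 128 * b := by field_simp

open Metric in
/-- Solutions of `cosh w ∈ 2ℤ + 1` form a net in the plane. -/
lemma exists_cosh_eq_odd (p : ℂ) : ∃ w ∈ ball p 6, ∃ n : ℤ, Complex.cosh w = 2 * n - 1 := by
  have key : ∀ x : ℝ, 0 ≤ x → ∃ y ∈ Icc x (x + 2), ∃ n : ℤ, Real.cosh y = 2 * n - 1 := by
    intro x hx
    have hgap : Real.cosh x + 2 ≤ Real.cosh (x + 2) := by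
      rw [Real.cosh_add]
      have h1 : 1 ≤ Real.cosh x := Real.one_le_cosh x
      have h2 : 0 ≤ Real.sinh x := Real.sinh_nonneg_iff.2 hx
      have h3 : 0 ≤ Real.sinh 2 := Real.sinh_nonneg_iff.2 (by norm_num)
      have h4 : 3 ≤ Real.cosh 2 := by
        rw [Real.cosh_eq]
        have e1 : (2.7 : ℝ) < Real.exp 1 := by linarith [Real.exp_one_gt_d9]
        have e2 : Real.exp 2 = Real.exp 1 * Real.exp 1 := by rw [← Real.exp_add]; norm_num
        have e3 := Real.exp_pos (-2)
        nlinarith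
      nlinarith [mul_nonneg h2 h3]
    set n : ℤ := ⌈(Real.cosh x + 1) / 2⌉ with hn
    have hn1 : (Real.cosh x + 1) / 2 ≤ n := Int.le_ceil _
    have hn2 : (n : ℝ) < (Real.cosh x + 1) / 2 + 1 := Int.ceil_lt_add_one _
    have := intermediate_value_Icc (by linarith : x ≤ x + 2)
      (Real.continuous_cosh.continuousOn)
    obtain ⟨y, hy, hy'⟩ := this (show (2 * (n : ℝ) - 1) ∈ Icc (Real.cosh x) (Real.cosh (x + 2)) from
      ⟨by linarith, by linarith⟩)
    exact ⟨y, hy, n, hy'⟩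
  obtain ⟨y, hy, n, hn⟩ : ∃ y : ℝ, |y - p.re| ≤ 2 ∧ ∃ n : ℤ, Real.cosh y = 2 * n - 1 := by
    rcases le_total 0 p.re with h | h
    · obtain ⟨y, hy, n, hn⟩ := key p.re h
      exact ⟨y, abs_le.2 ⟨by linarith [hy.1], by linarith [hy.2]⟩, n, hn⟩
    · obtain ⟨y, hy, n, hn⟩ := key (-p.re) (by linarith)
      exact ⟨-y, abs_le.2 ⟨by linarith [hy.2], by linarith [hy.1]⟩, n, by rw [Real.cosh_neg, hn]⟩
  set m : ℤ := round (p.im / (2 * Real.pi)) with hm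
  have hm' : |p.im - m * (2 * Real.pi)| ≤ Real.pi := by
    have h1 := abs_sub_round (p.im / (2 * Real.pi))
    rw [← hm] at h1
    have hpi := Real.pi_pos
    have : p.im - m * (2 * Real.pi) = (p.im / (2 * Real.pi) - m) * (2 * Real.pi) := by
      field_simp
    rw [this, abs_mul, abs_of_pos (by positivity : 0 < 2 * Real.pi)]
    nlinarith
  refine ⟨y + m * (2 * Real.pi * Complex.I), ?_, n, ?_⟩
  · rw [mem_ball, dist_eq_norm]
    refine (Complex.norm_le_abs_re_add_abs_im _).trans_lt ?_
    have h1 : ((y : ℂ) + m * (2 * Real.pi * Complex.I) - p).re = y - p.re := by simp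
    have h2 : ((y : ℂ) + m * (2 * Real.pi * Complex.I) - p).im = -(p.im - m * (2 * Real.pi)) := by
      simp
    rw [h1, h2, abs_neg]
    linarith [Real.pi_lt_d2]
  · have : Complex.cosh ((y : ℂ) + m * (2 * Real.pi * Complex.I)) = Complex.cosh y := by
      rw [Complex.cosh, Complex.cosh, neg_add, ← mul_comm _ (m : ℂ)]
      rw [Complex.exp_add, Complex.exp_add]
      have e1 : Complex.exp (2 * Real.pi * Complex.I * m) = 1 := by
        rw [mul_comm]; exact Complex.exp_int_mul_two_pi_mul_I m
      rw [Complex.exp_neg (2 * Real.pi * Complex.I * m), e1]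
      simp
    rw [this, ← Complex.ofReal_cosh, hn]
    push_cast; ring

open Metric in
/-- A form of Schottky's theorem, with a bound which is linear in `|log |q||`. -/
theorem schottky : ∃ C : ℝ, 0 < C ∧ ∀ (q : ℂ → ℂ) (c : ℂ) (R : ℝ), 0 < R →
    DifferentiableOn ℂ q (ball c R) → (∀ z ∈ ball c R, q z ≠ 0) → (∀ z ∈ ball c R, q z ≠ 1) →
    ∀ z ∈ closedBall c (R / 2), |Real.log ‖q z‖| ≤ C * (1 + |Real.log ‖q c‖|) := by
  set D : ℝ := 128 * 6 with hD
  refine ⟨20 * Real.pi * Real.exp D, by positivity, fun q c R hR hq h0 h1 z hz => ?_⟩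
  have hcm : c ∈ ball c R := mem_ball_self hR
  have hzm : z ∈ ball c R := closedBall_subset_ball (by linarith) hz
  obtain ⟨φ, hφd, hφc, hφ⟩ := exists_log_on_ball hR hq h0
  have hpi0 : (Real.pi : ℂ) ≠ 0 := by exact_mod_cast Real.pi_ne_zero
  set P : ℂ → ℂ := fun z => φ z / (Real.pi * Complex.I) - 1 with hP
  have hPd : DifferentiableOn ℂ P (ball c R) := (hφd.div_const _).sub_const _
  have hφP : ∀ z, φ z = Real.pi * Complex.I * (P z + 1) := by
    intro z; simp only [hP]; field_simp; ring
  have hodd : ∀ w ∈ ball c R, ∀ n : ℤ, P w ≠ 2 * n - 1 := by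
    intro w hw n hn
    apply h1 w hw
    rw [← hφ w hw, hφP, hn]
    convert Complex.exp_int_mul_two_pi_mul_I n using 2
    ring
  obtain ⟨σ, hσd, -, hσ⟩ := exists_log_on_ball (q := fun z => P z ^ 2 - 1) hR
    ((hPd.pow 2).sub_const _) (fun w hw h => by
      have : (P w - 1) * (P w + 1) = 0 := by linear_combination h
      rcases mul_eq_zero.1 this with h | h
      · exact hodd w hw 1 (by push_cast; linear_combination h)
      · exact hodd w hw 0 (by push_cast; linear_combination h))
  have hs2 : ∀ w ∈ ball c R, Complex.exp (σ w / 2) ^ 2 = P w ^ 2 - 1 := by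
    intro w hw
    rw [← hσ w hw, ← Complex.exp_nat_mul]; congr 1; push_cast; ring
  obtain ⟨G, hGd, -, hG⟩ := exists_log_on_ball (q := fun z => P z + Complex.exp (σ z / 2)) hR
    (hPd.add (hσd.div_const 2).cexp) (fun w hw h => by
      have : (P w + Complex.exp (σ w / 2)) * (P w - Complex.exp (σ w / 2)) = 1 := by
        linear_combination -(hs2 w hw)
      rw [h] at this; simp at this)
  have hcosh : ∀ w ∈ ball c R, Complex.cosh (G w) = P w := by
    intro w hw
    have hinv : Complex.exp (-G w) = P w - Complex.exp (σ w / 2) := by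
      rw [Complex.exp_neg, hG w hw]
      refine inv_eq_of_mul_eq_one_right ?_
      linear_combination -(hs2 w hw)
    rw [Complex.cosh, hinv, hG w hw]; ring
  have hGz : ‖G z - G c‖ ≤ D := by
    refine norm_sub_le_of_forall_not_ball_subset hR hGd (fun p hp => ?_) hz
    obtain ⟨w, hw, n, hn⟩ := exists_cosh_eq_odd p
    obtain ⟨v, hv, rfl⟩ := hp hw
    rw [hcosh v hv] at hn
    exact hodd v hv n hn
  have hre : |(G z).re| ≤ |(G c).re| + D := by
    have h2 : |(G z - G c).re| ≤ D := (Complex.abs_re_le_norm _).trans hGz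
    have h3 : (G z).re = (G z - G c).re + (G c).re := by simp
    rw [h3]
    linarith [abs_add_le (G z - G c).re (G c).re]
  have hup : ‖P z‖ ≤ Real.exp |(G z).re| := by
    rw [← hcosh z hzm, Complex.cosh]
    rw [norm_div, Complex.norm_ofNat, div_le_iff₀ (by norm_num)]
    refine (norm_add_le _ _).trans ?_
    rw [Complex.norm_exp, Complex.norm_exp, Complex.neg_re]
    have e1 : Real.exp (G z).re ≤ Real.exp |(G z).re| := Real.exp_le_exp.2 (le_abs_self _)
    have e2 : Real.exp (-(G z).re) ≤ Real.exp |(G z).re| := Real.exp_le_exp.2 (neg_le_abs _)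
    linarith
  have hlow : Real.exp |(G c).re| ≤ 2 * ‖P c‖ + 1 := by
    have e0 : 2 * P c = Complex.exp (G c) + Complex.exp (-G c) := by
      rw [← hcosh c hcm, Complex.cosh]; ring
    have e1 : ‖2 * P c‖ = 2 * ‖P c‖ := by simp
    rw [← e1, e0]
    rcases le_total 0 (G c).re with h | h
    · have := norm_sub_le_norm_add (Complex.exp (G c)) (Complex.exp (-G c))
      rw [Complex.norm_exp, Complex.norm_exp, Complex.neg_re] at this
      rw [abs_of_nonneg h]
      have : Real.exp (-(G c).re) ≤ 1 := Real.exp_le_one_iff.2 (by linarith)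
      linarith
    · have := norm_sub_le_norm_add (Complex.exp (-G c)) (Complex.exp (G c))
      rw [Complex.norm_exp, Complex.norm_exp, Complex.neg_re, add_comm (Complex.exp (-G c))] at this
      rw [abs_of_nonpos h]
      have : Real.exp ((G c).re) ≤ 1 := Real.exp_le_one_iff.2 (by linarith)
      linarith
  have hPz : ‖P z‖ ≤ Real.exp D * (2 * ‖P c‖ + 1) := by
    calc ‖P z‖ ≤ Real.exp (|(G c).re| + D) := hup.trans (Real.exp_le_exp.2 hre)
      _ = Real.exp D * Real.exp |(G c).re| := by rw [Real.exp_add]; ring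
      _ ≤ _ := by gcongr
  have hpi : 3 < Real.pi := Real.pi_gt_three
  have hlogz : |Real.log ‖q z‖| ≤ Real.pi * (‖P z‖ + 1) := by
    rw [← hφ z hzm, Complex.norm_exp, Real.log_exp]
    refine (Complex.abs_re_le_norm _).trans ?_
    rw [hφP, norm_mul, norm_mul, Complex.norm_I, Complex.norm_real,
      Real.norm_of_nonneg Real.pi_pos.le, mul_one]
    have := norm_add_le (P z) 1
    rw [norm_one] at this
    nlinarith
  have hPc : ‖P c‖ ≤ |Real.log ‖q c‖| + 2 := by
    have e1 : ‖φ c‖ ≤ |Real.log ‖q c‖| + Real.pi := by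
      refine (Complex.norm_le_abs_re_add_abs_im _).trans ?_
      rw [hφc, Complex.log_re, Complex.log_im]
      linarith [Complex.abs_arg_le_pi (q c)]
    have e2 : ‖P c‖ ≤ ‖φ c‖ / Real.pi + 1 := by
      simp only [hP]
      refine (norm_sub_le _ _).trans ?_
      rw [norm_div, norm_mul, Complex.norm_I, Complex.norm_real, norm_one,
        Real.norm_of_nonneg Real.pi_pos.le, mul_one]
    have e3 : ‖φ c‖ / Real.pi ≤ |Real.log ‖q c‖| + 1 := by
      rw [div_le_iff₀ Real.pi_pos]
      nlinarith [abs_nonneg (Real.log ‖q c‖)]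
    linarith
  have hE : 1 ≤ Real.exp D := Real.one_le_exp (by norm_num [hD])
  set L := |Real.log ‖q c‖| with hL
  have hL0 : 0 ≤ L := abs_nonneg _
  calc |Real.log ‖q z‖| ≤ Real.pi * (‖P z‖ + 1) := hlogz
    _ ≤ Real.pi * (Real.exp D * (2 * (L + 2) + 1) + Real.exp D) := by
      gcongr
      exact hPz.trans (by gcongr)
    _ = Real.pi * Real.exp D * (2 * L + 6) := by ring
    _ ≤ Real.pi * Real.exp D * (20 * (1 + L)) := by gcongr; linarith
    _ = 20 * Real.pi * Real.exp D * (1 + L) := by ring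

/-- A nonconstant entire function has real part of more than logarithmic growth. -/
lemma exists_lt_re_of_not_const {g : ℂ → ℂ} (hg : Differentiable ℂ g)
    (hg' : ¬ ∃ c : ℂ, ∀ z, g z = c) (α β : ℝ) :
    ∃ T : ℝ, ∀ t ≥ T, ∃ z : ℂ, ‖z‖ = Real.exp t ∧ α * t + β < (g z).re := by
  obtain ⟨z₁, hz₁⟩ : ∃ z₁, g z₁ ≠ g 0 := by
    by_contra h
    push Not at h
    exact hg' ⟨g 0, h⟩
  set c := ‖z₁‖ with hc
  set ε := ‖g z₁ - g 0‖ with hε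
  have hεpos : 0 < ε := norm_pos_iff.2 (sub_ne_zero.2 hz₁)
  set a := |α| with ha
  set b := |β| + |(g 0).re| + 1 with hb
  have hev := ((Real.tendsto_exp_div_pow_atTop 1).eventually_ge_atTop
    (2 * (a + b) * c / ε + c + 1)).and (eventually_ge_atTop (1 : ℝ))
  obtain ⟨T, hT⟩ := eventually_atTop.1 hev
  refine ⟨T, fun t ht => ?_⟩
  obtain ⟨h1, h2⟩ := hT t ht
  by_contra hcon
  push Not at hcon
  have ht0 : 0 < t := by linarith
  rw [pow_one, le_div_iff₀ ht0] at h1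
  have hc0 : 0 ≤ c := norm_nonneg _
  have ha0 : 0 ≤ a := abs_nonneg _
  have hb0 : 0 < b := by positivity
  have hX : 0 ≤ 2 * (a + b) * c / ε := by positivity
  have hcr : c < Real.exp t := by nlinarith
  have hre : ∀ z ∈ Metric.ball (0 : ℂ) (Real.exp t), (g z).re ≤ a * t + |β| := by
    intro z hz
    have := Complex.norm_le_of_forall_mem_frontier_norm_le (U := Metric.ball (0 : ℂ) (Real.exp t))
      (f := fun z => Complex.exp (g z)) (C := Real.exp (α * t + β)) Metric.isBounded_ball
      (hg.cexp.diffContOnCl) (fun w hw => by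
        rw [frontier_ball _ (Real.exp_pos t).ne', mem_sphere_zero_iff_norm] at hw
        rw [Complex.norm_exp]
        exact Real.exp_le_exp.2 (hcon w hw)) (subset_closure hz)
    rw [Complex.norm_exp, Real.exp_le_exp] at this
    refine this.trans ?_
    gcongr
    · exact le_abs_self _
    · exact le_abs_self _
  have hM : 0 < a * t + b := by positivity
  have hBC := Complex.borelCaratheodory_zero (f := fun z => g z - g 0) (z := z₁)
    (R := Real.exp t) hM (hg.sub_const _).differentiableOn (fun z hz => by
      have := hre z hz
      simp only [mem_ofPred_eq, Complex.sub_re]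
      linarith [neg_abs_le (g 0).re]) (Real.exp_pos t) (by simpa using hcr) (by simp)
  simp only [← hc, ← hε] at hBC
  rw [le_div_iff₀ (by linarith)] at hBC
  have h3 : ε * ((2 * (a + b) * c / ε + c + 1) * t - c) ≤ ε * (Real.exp t - c) := by gcongr
  have h4 : ε * ((2 * (a + b) * c / ε + c + 1) * t - c) =
      2 * (a + b) * c * t + ε * (c * (t - 1) + t) := by
    field_simp; ring
  have h5 : 0 < ε * (c * (t - 1) + t) := by
    have : 0 ≤ c * (t - 1) := mul_nonneg hc0 (by linarith)
    positivity
  have h6 : 2 * (a * t + b) * c ≤ 2 * (a + b) * c * t := by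
    have : b * c ≤ b * c * t := le_mul_of_one_le_right (by positivity) h2
    nlinarith
  linarith

/-- The closed annulus `{z : |log |z|| ≤ ρ}`. -/
def logAnnulus (ρ : ℝ) : Set ℂ := {z | z ≠ 0 ∧ |Real.log ‖z‖| ≤ ρ}

/-- Some value of an entire function on a circle has the same real part as the value at the
centre. -/
lemma exists_re_eq_re_zero {g : ℂ → ℂ} (hg : Differentiable ℂ g) {r : ℝ} (hr : 0 < r) :
    ∃ z, ‖z‖ = r ∧ (g z).re = (g 0).re := by
  have key : ∀ k : ℂ → ℂ, Differentiable ℂ k →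
      ∃ z ∈ Metric.sphere (0 : ℂ) r, (k 0).re ≤ (k z).re := by
    intro k hk
    obtain ⟨z, hz, hmax⟩ := Complex.exists_mem_frontier_isMaxOn_norm (U := Metric.ball (0 : ℂ) r)
      (f := fun z => Complex.exp (k z)) Metric.isBounded_ball ⟨0, Metric.mem_ball_self hr⟩
      hk.cexp.diffContOnCl
    rw [frontier_ball _ hr.ne'] at hz
    refine ⟨z, hz, ?_⟩
    have := hmax (subset_closure (Metric.mem_ball_self hr))
    simpa [Complex.norm_exp] using this
  obtain ⟨z₁, hz₁, h₁⟩ := key g hg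
  obtain ⟨z₂, hz₂, h₂⟩ := key (fun z => -g z) hg.neg
  have hconn : IsPreconnected (Metric.sphere (0 : ℂ) r) :=
    isPreconnected_sphere (by simp) 0 r
  have hcont : ContinuousOn (fun z => (g z).re) (Metric.sphere (0 : ℂ) r) :=
    (Complex.continuous_re.comp hg.continuous).continuousOn
  obtain ⟨z, hz, h⟩ := hconn.intermediate_value hz₂ hz₁ hcont
    (show (g 0).re ∈ Icc _ _ from ⟨by simpa using h₂, h₁⟩)
  exact ⟨z, by simpa using hz, h⟩

lemma IsTranscendentalSelfMapCStar.differentiableOn {f : ℂ → ℂ}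
    (hf : IsTranscendentalSelfMapCStar f) : DifferentiableOn ℂ f {0}ᶜ := by
  obtain ⟨m, g, h, hg, hh, -, -, hfz⟩ := hf
  refine DifferentiableOn.congr (f := fun z => z ^ m * Complex.exp (g z + h z⁻¹)) ?_ hfz
  intro z hz
  have hz' : z ≠ 0 := hz
  refine DifferentiableAt.differentiableWithinAt ?_
  refine (differentiableAt_zpow.2 (Or.inl hz')).mul (DifferentiableAt.cexp ?_)
  exact (hg z).add ((hh z⁻¹).comp z (differentiableAt_inv hz'))

lemma IsTranscendentalSelfMapCStar.ne_zero {f : ℂ → ℂ}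
    (hf : IsTranscendentalSelfMapCStar f) {z : ℂ} (hz : z ≠ 0) : f z ≠ 0 := by
  obtain ⟨m, g, h, -, -, -, -, hfz⟩ := hf
  rw [hfz z hz]
  exact mul_ne_zero (zpow_ne_zero _ hz) (Complex.exp_ne_zero _)

/-- Covering theorem: large annuli cover bigger annuli. -/
theorem IsTranscendentalSelfMapCStar.exists_logAnnulus_subset_image {f : ℂ → ℂ}
    (hf : IsTranscendentalSelfMapCStar f) :
    ∃ ρ₀ : ℝ, 0 < ρ₀ ∧ ∀ ρ ≥ ρ₀, logAnnulus (ρ + 1) ⊆ f '' logAnnulus ρ := by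
  have hfd := hf.differentiableOn
  have hf0 : ∀ z ≠ 0, f z ≠ 0 := fun z hz => hf.ne_zero hz
  obtain ⟨m, g, h, hg, hh, hg', -, hfz⟩ := hf
  obtain ⟨C, hC, hS⟩ := schottky
  obtain ⟨H, hH⟩ := (isCompact_closedBall (0 : ℂ) 1).exists_bound_of_continuousOn
    hh.continuous.continuousOn
  set μ : ℝ := |(m : ℝ)| with hμ
  set A := |(g 0).re| with hA
  have hlog : ∀ z ≠ 0, Real.log ‖f z‖ = m * Real.log ‖z‖ + (g z).re + (h z⁻¹).re := by
    intro z hz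
    rw [hfz z hz, norm_mul, norm_zpow, Real.log_mul (zpow_ne_zero _ (norm_ne_zero_iff.2 hz))
      (norm_ne_zero_iff.2 (Complex.exp_ne_zero _)), Real.log_zpow, Complex.norm_exp, Real.log_exp,
      Complex.add_re]
    ring
  obtain ⟨T, hT⟩ := exists_lt_re_of_not_const hg hg' (C * (μ + 1) + 1 + μ)
    (C * (22 + A + H) + 21 + H)
  refine ⟨max T 0 + 20, by positivity, fun ρ hρ w hw => ?_⟩
  by_contra hcon
  obtain ⟨t, rfl⟩ : ∃ t, ρ = t + 20 := ⟨ρ - 20, by ring⟩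
  have hmt : max T 0 ≤ t := by linarith
  have ht0 : 0 ≤ t := (le_max_right _ _).trans hmt
  obtain ⟨z, hz, hzlt⟩ := hT t ((le_max_left _ _).trans hmt)
  obtain ⟨z', hz', hgz'⟩ := exists_re_eq_re_zero hg (Real.exp_pos t)
  have hne : ∀ {x : ℂ}, ‖x‖ = Real.exp t → x ≠ 0 := fun {x} hx =>
    norm_ne_zero_iff.1 (hx ▸ (Real.exp_pos t).ne')
  have hhb : ∀ {x : ℂ}, ‖x‖ = Real.exp t → |(h x⁻¹).re| ≤ H := fun {x} hx => by
    refine (Complex.abs_re_le_norm _).trans (hH _ ?_)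
    rw [mem_closedBall_zero_iff, norm_inv, hx, ← Real.exp_neg]
    exact Real.exp_le_one_iff.2 (by linarith)
  have hmt' : |(m : ℝ) * t| ≤ μ * t := by rw [abs_mul, abs_of_nonneg ht0]
  have hw0 : w ≠ 0 := hw.1
  have hwl : |Real.log ‖w‖| ≤ t + 21 := by linarith [hw.2]
  have hmem : ∀ ζ ∈ Metric.ball (Complex.log z') 20, Complex.exp ζ ∈ logAnnulus (t + 20) := by
    intro ζ hζ
    refine ⟨Complex.exp_ne_zero _, ?_⟩
    rw [Complex.norm_exp, Real.log_exp]
    have h1 : |(ζ - Complex.log z').re| < 20 :=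
      (Complex.abs_re_le_norm _).trans_lt (by simpa [dist_eq_norm] using hζ)
    rw [Complex.sub_re, Complex.log_re, hz', Real.log_exp] at h1
    rw [abs_lt] at h1
    exact abs_le.2 ⟨by linarith, by linarith⟩
  have hsch := hS (fun ζ => f (Complex.exp ζ) / w) (Complex.log z') 20 (by norm_num)
    ((hfd.comp Complex.differentiable_exp.differentiableOn
      (fun ζ hζ => (hmem ζ hζ).1)).div_const w)
    (fun ζ hζ => div_ne_zero (hf0 _ (hmem ζ hζ).1) hw0)
    (fun ζ hζ h1 => hcon ⟨_, hmem ζ hζ, by rwa [div_eq_one_iff_eq hw0] at h1⟩)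
    (Complex.log z) (by
      rw [Metric.mem_closedBall, dist_eq_norm]
      refine (Complex.norm_le_abs_re_add_abs_im _).trans ?_
      rw [Complex.sub_re, Complex.sub_im, Complex.log_re, Complex.log_re, hz, hz', sub_self,
        abs_zero, zero_add, Complex.log_im, Complex.log_im]
      have := abs_sub (Complex.arg z) (Complex.arg z')
      linarith [Complex.abs_arg_le_pi z, Complex.abs_arg_le_pi z', Real.pi_lt_d2])
  rw [Complex.exp_log (hne hz), Complex.exp_log (hne hz'), norm_div, norm_div,
    Real.log_div (norm_ne_zero_iff.2 (hf0 _ (hne hz))) (norm_ne_zero_iff.2 hw0),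
    Real.log_div (norm_ne_zero_iff.2 (hf0 _ (hne hz'))) (norm_ne_zero_iff.2 hw0),
    hlog z (hne hz), hlog z' (hne hz'), hz, hz', Real.log_exp, hgz'] at hsch
  have e1 : |m * t + (g 0).re + (h z'⁻¹).re - Real.log ‖w‖| ≤ μ * t + A + H + (t + 21) := by
    have a1 := abs_sub (m * t + (g 0).re + (h z'⁻¹).re) (Real.log ‖w‖)
    have a2 := abs_add_three (m * t) (g 0).re (h z'⁻¹).re
    linarith [hhb hz']
  have e2 := hsch.trans (mul_le_mul_of_nonneg_left (add_le_add_right e1 1) hC.le)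
  have e3 := (le_abs_self _).trans e2
  have e4 := neg_le_of_abs_le (hhb hz)
  have e5 := neg_le_of_abs_le hmt'
  have e6 := le_of_abs_le hwl
  linarith

lemma logAnnulus_mono {ρ ρ' : ℝ} (h : ρ ≤ ρ') : logAnnulus ρ ⊆ logAnnulus ρ' :=
  fun _ hz => ⟨hz.1, hz.2.trans h⟩

lemma logAnnulus_eq (ρ : ℝ) :
    logAnnulus ρ = {z | Real.exp (-ρ) ≤ ‖z‖} ∩ Metric.closedBall 0 (Real.exp ρ) := by
  ext z
  simp only [logAnnulus, mem_ofPred_eq, mem_inter_iff, mem_closedBall_zero_iff, abs_le]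
  constructor
  · rintro ⟨hz, h1, h2⟩
    have hz' := norm_pos_iff.2 hz
    exact ⟨(Real.le_log_iff_exp_le hz').1 h1, (Real.log_le_iff_le_exp hz').1 h2⟩
  · rintro ⟨h1, h2⟩
    have hz' : 0 < ‖z‖ := (Real.exp_pos _).trans_le h1
    exact ⟨norm_pos_iff.1 hz', (Real.le_log_iff_exp_le hz').2 h1,
      (Real.log_le_iff_le_exp hz').2 h2⟩

lemma isCompact_logAnnulus (ρ : ℝ) : IsCompact (logAnnulus ρ) := by
  rw [logAnnulus_eq]
  exact (isCompact_closedBall 0 _).inter_left (isClosed_le continuous_const continuous_norm)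

lemma continuousOn_log_norm : ContinuousOn (fun z : ℂ => Real.log ‖z‖) {0}ᶜ :=
  continuous_norm.continuousOn.log fun _ hz => norm_ne_zero_iff.2 hz

lemma isOpen_abs_log_lt (ρ : ℝ) : IsOpen {z : ℂ | z ≠ 0 ∧ |Real.log ‖z‖| < ρ} := by
  have := continuousOn_log_norm.abs.isOpen_inter_preimage isOpen_compl_singleton
    (isOpen_Iio (a := ρ))
  exact this

lemma exists_subset_logAnnulus {K : Set ℂ} (hK : IsCompact K) (h0 : 0 ∉ K) :
    ∃ ρ, K ⊆ logAnnulus ρ := by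
  have hsub : K ⊆ {0}ᶜ := fun z hz h => h0 (h ▸ hz)
  obtain ⟨ρ, hρ⟩ := hK.exists_bound_of_continuousOn (continuousOn_log_norm.mono hsub)
  exact ⟨ρ, fun z hz => ⟨hsub hz, hρ z hz⟩⟩

lemma one_mem_logAnnulus {ρ : ℝ} (h : 0 ≤ ρ) : (1 : ℂ) ∈ logAnnulus ρ :=
  ⟨one_ne_zero, by simpa using h⟩

/-- A holomorphic self-map of the punctured plane with the covering property that large annuli
cover bigger annuli. -/
structure IsExpanding (f : ℂ → ℂ) (ρ₀ : ℝ) : Prop where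
  differentiableOn : DifferentiableOn ℂ f {0}ᶜ
  ne_zero : ∀ z ≠ 0, f z ≠ 0
  pos : 0 < ρ₀
  subset_image : ∀ ρ ≥ ρ₀, logAnnulus (ρ + 1) ⊆ f '' logAnnulus ρ

namespace IsExpanding

variable {f : ℂ → ℂ} {ρ₀ : ℝ}

lemma iterate_ne_zero (hf : IsExpanding f ρ₀) (n : ℕ) {z : ℂ} (hz : z ≠ 0) : f^[n] z ≠ 0 := by
  induction n with
  | zero => exact hz
  | succ n ih => rw [iterate_succ_apply']; exact hf.ne_zero _ ih

lemma iterate_differentiableOn (hf : IsExpanding f ρ₀) (n : ℕ) :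
    DifferentiableOn ℂ f^[n] {0}ᶜ :=
  hf.differentiableOn.iterate (fun z hz => hf.ne_zero z hz) n

lemma iterate_continuousOn (hf : IsExpanding f ρ₀) (n : ℕ) : ContinuousOn f^[n] {0}ᶜ :=
  (hf.iterate_differentiableOn n).continuousOn

lemma iterate_analyticOnNhd (hf : IsExpanding f ρ₀) (n : ℕ) : AnalyticOnNhd ℂ f^[n] {0}ᶜ :=
  (hf.iterate_differentiableOn n).analyticOnNhd isOpen_compl_singleton

lemma mem_escapingSet_iff (hf : IsExpanding f ρ₀) {z : ℂ} :
    z ∈ escapingSet f ↔ z ≠ 0 ∧ ∀ ρ : ℝ, ∀ᶠ n in atTop, ρ < |Real.log ‖f^[n] z‖| := by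
  refine and_congr_right fun hz => ?_
  have hpos : ∀ n, 0 < ‖f^[n] z‖ := fun n => norm_pos_iff.2 (hf.iterate_ne_zero n hz)
  have key : ∀ n (ρ : ℝ), ρ < |Real.log ‖f^[n] z‖| ↔
      ‖f^[n] z‖ < Real.exp (-ρ) ∨ 1 / Real.exp (-ρ) < ‖f^[n] z‖ := by
    intro n ρ
    rw [one_div, ← Real.exp_neg, neg_neg, lt_abs, Real.lt_log_iff_exp_lt (hpos n), lt_neg,
      Real.log_lt_iff_lt_exp (hpos n), or_comm]
  constructor
  · intro h ρ
    obtain ⟨N, hN⟩ := h _ (Real.exp_pos (-ρ))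
    exact eventually_atTop.2 ⟨N, fun n hn => (key n ρ).2 (hN n hn)⟩
  · intro h ε hε
    obtain ⟨N, hN⟩ := eventually_atTop.1 (h (-Real.log ε))
    refine ⟨N, fun n hn => ?_⟩
    have := (key n _).1 (hN n hn)
    rwa [neg_neg, Real.exp_log hε] at this

lemma iterate_mem_escapingSet_iff (hf : IsExpanding f ρ₀) (k : ℕ) {z : ℂ} (hz : z ≠ 0) :
    f^[k] z ∈ escapingSet f ↔ z ∈ escapingSet f := by
  rw [hf.mem_escapingSet_iff, hf.mem_escapingSet_iff]
  simp only [hz, hf.iterate_ne_zero k hz, ne_eq, not_false_eq_true, true_and]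
  refine forall_congr' fun ρ => ?_
  simp only [← iterate_add_apply]
  constructor
  · intro h
    obtain ⟨N, hN⟩ := eventually_atTop.1 h
    refine eventually_atTop.2 ⟨N + k, fun n hn => ?_⟩
    have := hN (n - k) (by omega)
    rwa [Nat.sub_add_cancel (by omega)] at this
  · intro h
    exact (tendsto_add_atTop_nat k).eventually h

lemma logAnnulus_subset_iterate_image (hf : IsExpanding f ρ₀) (n : ℕ) :
    logAnnulus (ρ₀ + n) ⊆ f^[n] '' logAnnulus ρ₀ := by
  induction n with
  | zero => simp
  | succ n ih =>
    rw [iterate_succ', image_comp]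
    have := hf.subset_image (ρ₀ + n) (by simp)
    push_cast
    rw [← add_assoc]
    exact this.trans (image_mono ih)

lemma iterate_not_const (hf : IsExpanding f ρ₀) (n : ℕ) : ¬ ∃ w, ∀ z ≠ 0, f^[n] z = w := by
  rintro ⟨w, hw⟩
  have key : ∀ a ∈ logAnnulus ρ₀, a = w := by
    intro a ha
    obtain ⟨x, hx, rfl⟩ := hf.logAnnulus_subset_iterate_image n
      (logAnnulus_mono (by simp) ha)
    exact hw x hx.1
  have h1 := key 1 (one_mem_logAnnulus hf.pos.le)
  have h2 := key (Real.exp ρ₀ : ℝ) ⟨by simp, by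
    rw [Complex.norm_real, Real.norm_of_nonneg (Real.exp_pos _).le, Real.log_exp,
      abs_of_pos hf.pos]⟩
  rw [← h1] at h2
  have : Real.exp ρ₀ = 1 := by exact_mod_cast h2
  rw [Real.exp_eq_one_iff] at this
  exact hf.pos.ne' this

lemma isPreconnected_compl_zero : IsPreconnected ({0}ᶜ : Set ℂ) :=
  (isConnected_compl_singleton_of_one_lt_rank (by simp) 0).isPreconnected

lemma iterate_isOpen_image (hf : IsExpanding f ρ₀) (n : ℕ) {s : Set ℂ} (hs : IsOpen s)
    (h0 : 0 ∉ s) : IsOpen (f^[n] '' s) := by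
  rcases (hf.iterate_analyticOnNhd n).is_constant_or_isOpen isPreconnected_compl_zero with h | h
  · exact absurd h (hf.iterate_not_const n)
  · exact h s (fun z hz h => h0 (h ▸ hz)) hs

lemma not_isLocalMax_iterate (hf : IsExpanding f ρ₀) (n : ℕ) {x : ℂ} (hx : x ≠ 0) :
    ¬ IsLocalMax (fun z => ‖f^[n] z‖) x := by
  intro h
  have h1 := Complex.eventually_eq_of_isLocalMax_norm (f := f^[n]) (c := x)
    (by
      filter_upwards [isOpen_compl_singleton.mem_nhds hx] with z hz
      exact (hf.iterate_differentiableOn n).differentiableAt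
        (isOpen_compl_singleton.mem_nhds hz)) h
  have h2 := (hf.iterate_analyticOnNhd n).eqOn_of_preconnected_of_eventuallyEq
    (g := fun _ => f^[n] x) analyticOnNhd_const isPreconnected_compl_zero hx h1
  exact hf.iterate_not_const n ⟨_, h2⟩

/-- Points all of whose iterates are dominated in modulus by the maximum modulus of the iterates
on a reference annulus. -/
def dominated (f : ℂ → ℂ) (ρ₀ : ℝ) (n : ℕ) : Set ℂ :=
  {w | w ≠ 0 ∧ ∀ j, ∃ x ∈ logAnnulus ρ₀, ‖f^[j] w‖ ≤ ‖f^[n + j] x‖}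

lemma apply_mem_dominated (hf : IsExpanding f ρ₀) {n : ℕ} {w : ℂ} (hw : w ∈ dominated f ρ₀ n) :
    f w ∈ dominated f ρ₀ (n + 1) := by
  refine ⟨hf.ne_zero _ hw.1, fun j => ?_⟩
  obtain ⟨x, hx, h⟩ := hw.2 (j + 1)
  exact ⟨x, hx, by rwa [← iterate_succ_apply, add_assoc, add_comm 1 j]⟩

lemma logAnnulus_subset_dominated (hf : IsExpanding f ρ₀) (n : ℕ) :
    logAnnulus (ρ₀ + n) ⊆ dominated f ρ₀ n := by
  intro w hw
  refine ⟨hw.1, fun j => ?_⟩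
  obtain ⟨x, hx, rfl⟩ := hf.logAnnulus_subset_iterate_image n hw
  exact ⟨x, hx, by rw [← iterate_add_apply, add_comm]⟩

lemma iterate_mem_dominated_of_frontier (hf : IsExpanding f ρ₀) {U : Set ℂ}
    (hcl : IsCompact (closure U)) (h0 : 0 ∉ closure U) {N n : ℕ}
    (h : ∀ ζ ∈ frontier U, f^[N] ζ ∈ dominated f ρ₀ n) {z : ℂ} (hz : z ∈ U) :
    f^[N] z ∈ dominated f ρ₀ n := by
  have hsub : closure U ⊆ {0}ᶜ := fun z hz h => h0 (h ▸ hz)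
  refine ⟨hf.iterate_ne_zero N (hsub (subset_closure hz)), fun j => ?_⟩
  obtain ⟨x, hx, hmax⟩ := (isCompact_logAnnulus ρ₀).exists_isMaxOn
    ⟨1, one_mem_logAnnulus hf.pos.le⟩
    ((hf.iterate_continuousOn (n + j)).norm.mono fun z hz => hz.1)
  refine ⟨x, hx, ?_⟩
  rw [← iterate_add_apply]
  refine Complex.norm_le_of_forall_mem_frontier_norm_le
    (hcl.isBounded.subset subset_closure)
    ((hf.iterate_differentiableOn (j + N)).mono hsub).diffContOnCl (fun ζ hζ => ?_)
    (subset_closure hz)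
  obtain ⟨y, hy, hle⟩ := (h ζ hζ).2 j
  rw [iterate_add_apply]
  exact hle.trans (hmax hy)

lemma exists_iterate_notMem_dominated (hf : IsExpanding f ρ₀) (n : ℕ) :
    ∃ a ∈ logAnnulus (ρ₀ + 1), f^[n] a ∉ dominated f ρ₀ n := by
  by_contra hcon
  push Not at hcon
  obtain ⟨x, hx, hmax⟩ := (isCompact_logAnnulus ρ₀).exists_isMaxOn
    ⟨1, one_mem_logAnnulus hf.pos.le⟩
    ((hf.iterate_continuousOn n).norm.mono fun z hz => hz.1)
  refine hf.not_isLocalMax_iterate n hx.1 ?_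
  filter_upwards [(isOpen_abs_log_lt (ρ₀ + 1)).mem_nhds
    (show x ∈ _ from ⟨hx.1, by linarith [hx.2]⟩)] with y hy
  obtain ⟨v, hv, hle⟩ := (hcon y ⟨hy.1, hy.2.le⟩).2 0
  exact hle.trans (hmax hv)

lemma exists_forall_iterate_mem_dominated (hf : IsExpanding f ρ₀) {S : Set ℂ}
    (hS : IsCompact S) (h0 : 0 ∉ S) (hI : Disjoint S (escapingSet f)) (k : ℕ) :
    ∃ n, ∀ ζ ∈ S, f^[n + k] ζ ∈ dominated f ρ₀ n := by
  by_contra hcon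
  push Not at hcon
  have hS0 : S ⊆ {0}ᶜ := fun z hz h => h0 (h ▸ hz)
  set T : ℕ → Set ℂ := fun n => {ζ ∈ S | f^[n + k] ζ ∉ dominated f ρ₀ n} with hT
  have hanti : ∀ n, T (n + 1) ⊆ T n := by
    intro n ζ hζ
    refine ⟨hζ.1, fun h => hζ.2 ?_⟩
    rw [show n + 1 + k = (n + k) + 1 by ring, iterate_succ_apply']
    exact hf.apply_mem_dominated h
  have hTS : ∀ n, closure (T n) ⊆ S := fun n =>
    closure_minimal (sep_subset _ _) hS.isClosed
  obtain ⟨ζ, hζ⟩ := IsCompact.nonempty_iInter_of_sequence_nonempty_isCompact_isClosed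
    (fun n => closure (T n)) (fun n => closure_mono (hanti n))
    (fun n => (hcon n).imp fun ζ hζ => subset_closure hζ)
    (hS.of_isClosed_subset isClosed_closure (hTS 0)) (fun n => isClosed_closure)
  rw [mem_iInter] at hζ
  have hζS : ζ ∈ S := hTS 0 (hζ 0)
  have hle : ∀ n : ℕ, ρ₀ + n ≤ |Real.log ‖f^[n] (f^[k] ζ)‖| := by
    intro n
    by_contra hlt
    push Not at hlt
    rw [← iterate_add_apply] at hlt
    have hc : ContinuousAt (fun z => |Real.log ‖f^[n + k] z‖|) ζ :=
      ((((hf.iterate_continuousOn (n + k)).continuousAt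
        (isOpen_compl_singleton.mem_nhds (hS0 hζS))).norm).log
          (norm_ne_zero_iff.2 (hf.iterate_ne_zero _ (hS0 hζS)))).abs
    obtain ⟨y, hy, hyT⟩ := mem_closure_iff_nhds.1 (hζ n) _ (hc.eventually (gt_mem_nhds hlt))
    exact hyT.2 (hf.logAnnulus_subset_dominated n
      ⟨hf.iterate_ne_zero _ (hS0 hyT.1), le_of_lt hy⟩)
  refine hI.notMem_of_mem_left hζS ((hf.iterate_mem_escapingSet_iff k (hS0 hζS)).1 ?_)
  refine hf.mem_escapingSet_iff.2 ⟨hf.iterate_ne_zero k (hS0 hζS), fun ρ => ?_⟩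
  filter_upwards [(tendsto_natCast_atTop_atTop (R := ℝ)).eventually_gt_atTop ρ] with n hn
  linarith [hle n, hf.pos]

/-- If the boundary of `U` does not escape, every iterated image of `U` omits a point of a fixed
annulus. -/
lemma exists_notMem_iterate_image (hf : IsExpanding f ρ₀) {U : Set ℂ}
    (hcl : IsCompact (closure U)) (h0 : 0 ∉ closure U)
    (hI : Disjoint (frontier U) (escapingSet f)) (k : ℕ) :
    ∃ a ∈ logAnnulus (ρ₀ + 1), a ∉ f^[k] '' U := by
  obtain ⟨n, hn⟩ := hf.exists_forall_iterate_mem_dominated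
    (hcl.of_isClosed_subset isClosed_frontier frontier_subset_closure)
    (fun h => h0 (frontier_subset_closure h)) hI k
  obtain ⟨a, ha, hna⟩ := hf.exists_iterate_notMem_dominated n
  refine ⟨a, ha, ?_⟩
  rintro ⟨z, hz, rfl⟩
  rw [← iterate_add_apply] at hna
  exact hna (hf.iterate_mem_dominated_of_frontier hcl h0 hn hz)

/-- A domain meeting the escaping set whose boundary does not escape is contained in the
escaping set. -/
lemma subset_escapingSet (hf : IsExpanding f ρ₀) {U : Set ℂ} (hU : IsOpen U)
    (hconn : IsPreconnected U) (hcl : IsCompact (closure U)) (h0 : 0 ∉ closure U)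
    (hI : Disjoint (frontier U) (escapingSet f)) (hne : (U ∩ escapingSet f).Nonempty) :
    U ⊆ escapingSet f := by
  choose a ha ha' using hf.exists_notMem_iterate_image hcl h0 hI
  obtain ⟨C, hC, hS⟩ := schottky
  have hU0 : U ⊆ {0}ᶜ := fun z hz h => h0 (h ▸ subset_closure hz)
  have key : ∀ (z : ℂ) (r : ℝ), 0 < r → Metric.ball z r ⊆ U →
      ∀ y ∈ Metric.closedBall z (r / 2), y ∈ escapingSet f → z ∈ escapingSet f := by
    intro z r hr hzr y hy hyI
    have hzU : z ∈ U := hzr (Metric.mem_ball_self hr)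
    have hyU : y ∈ U := hzr (Metric.closedBall_subset_ball (by linarith) hy)
    refine hf.mem_escapingSet_iff.2 ⟨hU0 hzU, fun ρ => ?_⟩
    filter_upwards [(hf.mem_escapingSet_iff.1 hyI).2 (C * (1 + (ρ + (ρ₀ + 1))) + (ρ₀ + 1))]
      with k hk
    have := hS (fun w => f^[k] w / a k) z r hr
      (((hf.iterate_differentiableOn k).mono (hzr.trans hU0)).div_const _)
      (fun w hw => div_ne_zero (hf.iterate_ne_zero k (hU0 (hzr hw))) (ha k).1)
      (fun w hw h => ha' k ⟨w, hzr hw, by rwa [div_eq_one_iff_eq (ha k).1] at h⟩) y hy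
    rw [norm_div, norm_div, Real.log_div (norm_ne_zero_iff.2 (hf.iterate_ne_zero k (hU0 hyU)))
      (norm_ne_zero_iff.2 (ha k).1), Real.log_div
      (norm_ne_zero_iff.2 (hf.iterate_ne_zero k (hU0 hzU))) (norm_ne_zero_iff.2 (ha k).1)] at this
    by_contra hcon
    push Not at hcon
    have h1 := abs_sub_abs_le_abs_sub (Real.log ‖f^[k] y‖) (Real.log ‖a k‖)
    have h2 : |Real.log ‖f^[k] z‖ - Real.log ‖a k‖| ≤ ρ + (ρ₀ + 1) :=
      (abs_sub _ _).trans (add_le_add hcon (ha k).2)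
    have h3 : C * (1 + |Real.log ‖f^[k] z‖ - Real.log ‖a k‖|) ≤ C * (1 + (ρ + (ρ₀ + 1))) := by
      gcongr
    linarith [(ha k).2]
  have hopen : IsOpen (U ∩ escapingSet f) := by
    refine Metric.isOpen_iff.2 fun z hz => ?_
    obtain ⟨r, hr, hzr⟩ := Metric.isOpen_iff.1 hU z hz.1
    refine ⟨r / 4, by positivity, fun y hy => ?_⟩
    have hyz : dist y z < r / 4 := hy
    have hyr : Metric.ball y (r / 2) ⊆ U :=
      (Metric.ball_subset_ball' (by linarith)).trans hzr
    refine ⟨hyr (Metric.mem_ball_self (by positivity)), key y (r / 2) (by positivity) hyr z ?_ hz.2⟩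
    rw [Metric.mem_closedBall, dist_comm]
    linarith
  refine (hconn.subset_of_closure_inter_subset hopen (by rwa [← inter_assoc, inter_self]) ?_).trans
    inter_subset_right
  rintro z ⟨hzc, hzU⟩
  obtain ⟨r, hr, hzr⟩ := Metric.isOpen_iff.1 hU z hzU
  obtain ⟨y, hy, hyI⟩ := mem_closure_iff_nhds.1 hzc _ (Metric.ball_mem_nhds z (half_pos hr))
  exact ⟨hzU, key z r hr hzr y (Metric.ball_subset_closedBall hy) hyI.2⟩

/-- The iterated images of such a domain are disjoint. -/
lemma disjoint_iterate_image (hf : IsExpanding f ρ₀) {U : Set ℂ} (hU : IsOpen U)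
    (hconn : IsPreconnected U) (hcl : IsCompact (closure U)) (h0 : 0 ∉ closure U)
    (hI : Disjoint (frontier U) (escapingSet f)) (hUI : U ⊆ escapingSet f) {j k : ℕ}
    (hjk : j < k) : Disjoint (f^[j] '' U) (f^[k] '' U) := by
  rw [Set.disjoint_iff_inter_eq_empty]
  by_contra hne
  rw [← ne_eq, ← nonempty_iff_ne_empty] at hne
  have hcl0 : closure U ⊆ {0}ᶜ := fun z hz h => h0 (h ▸ hz)
  have hU0 : U ⊆ {0}ᶜ := subset_closure.trans hcl0
  have hcomp : IsCompact (f^[j] '' closure U) :=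
    hcl.image_of_continuousOn ((hf.iterate_continuousOn j).mono hcl0)
  have hsub : f^[k] '' U ⊆ f^[j] '' U := by
    refine (hconn.image _ ((hf.iterate_continuousOn k).mono hU0)).subset_of_closure_inter_subset
      (hf.iterate_isOpen_image j hU fun h => hU0 h rfl) (by rwa [inter_comm]) ?_
    rintro w ⟨hw, z, hz, rfl⟩
    obtain ⟨ζ, hζ, hζe⟩ := closure_minimal (image_mono subset_closure) hcomp.isClosed hw
    by_cases hζU : ζ ∈ U
    · exact ⟨ζ, hζU, hζe⟩
    · exfalso
      refine hI.notMem_of_mem_left (show ζ ∈ frontier U from ⟨hζ, by rwa [hU.interior_eq]⟩) ?_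
      rw [← hf.iterate_mem_escapingSet_iff j (hcl0 hζ), hζe,
        hf.iterate_mem_escapingSet_iff k (hU0 hz)]
      exact hUI hz
  obtain ⟨z, hz⟩ : U.Nonempty := by
    obtain ⟨-, ⟨z, hz, -⟩, -⟩ := hne
    exact ⟨z, hz⟩
  obtain ⟨d, rfl⟩ : ∃ d, k = d + j := ⟨k - j, by omega⟩
  have hmaps : MapsTo f^[d] (f^[j] '' U) (f^[j] '' U) := by
    rintro _ ⟨y, hy, rfl⟩
    rw [← iterate_add_apply]
    exact hsub ⟨y, hy, rfl⟩
  obtain ⟨ρ, hρ⟩ := exists_subset_logAnnulus hcomp (by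
    rintro ⟨y, hy, hy0⟩
    exact hf.iterate_ne_zero j (hcl0 hy) hy0)
  have hesc := (hf.mem_escapingSet_iff.1
    ((hf.iterate_mem_escapingSet_iff j (hU0 hz)).2 (hUI hz))).2 ρ
  obtain ⟨N, hN⟩ := eventually_atTop.1 hesc
  have h1 := hN (d * N) (Nat.le_mul_of_pos_left N (by omega))
  rw [iterate_mul] at h1
  have h2 := hρ (image_mono subset_closure (hmaps.iterate N ⟨z, hz, rfl⟩))
  linarith [h2.2]

end IsExpanding

/-- Continuous functions with the mean value property on an open set. -/
def HasMeanValue (U : Set ℂ) (W : ℂ → ℝ) : Prop :=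
  ContinuousOn W U ∧ ∀ (c : ℂ) (r : ℝ), 0 < r → Metric.closedBall c r ⊆ U →
    ∫ t in (0 : ℝ)..(2 * Real.pi), W (circleMap c r t) = 2 * Real.pi * W c

lemma HasMeanValue.continuous_comp_circleMap {U : Set ℂ} {W : ℂ → ℝ} (hW : HasMeanValue U W) {c : ℂ}
    {r : ℝ} (hr : 0 < r) (h : Metric.closedBall c r ⊆ U) :
    Continuous fun t => W (circleMap c r t) :=
  hW.1.comp_continuous (continuous_circleMap c r) fun t =>
    h (Metric.sphere_subset_closedBall (circleMap_mem_sphere c hr.le t))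

lemma HasMeanValue.add_const {U : Set ℂ} {W : ℂ → ℝ} (hW : HasMeanValue U W) (b : ℝ) :
    HasMeanValue U fun z => W z + b := by
  refine ⟨hW.1.add continuousOn_const, fun c r hr h => ?_⟩
  rw [intervalIntegral.integral_add ((hW.continuous_comp_circleMap hr h).intervalIntegrable _ _)
    intervalIntegrable_const, hW.2 c r hr h]
  simp
  ring

lemma HasMeanValue.sum {ι : Type*} {U : Set ℂ} {W : ι → ℂ → ℝ} (s : Finset ι)
    (hW : ∀ i ∈ s, HasMeanValue U (W i)) : HasMeanValue U fun z => ∑ i ∈ s, W i z := by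
  refine ⟨continuousOn_finsetSum _ fun i hi => (hW i hi).1, fun c r hr h => ?_⟩
  rw [intervalIntegral.integral_finsetSum fun i hi =>
    ((hW i hi).continuous_comp_circleMap hr h).intervalIntegrable _ _, Finset.mul_sum]
  exact Finset.sum_congr rfl fun i hi => (hW i hi).2 c r hr h

/-- Minimum principle: a function with the mean value property cannot be larger off a compact
set than at some point. -/
lemma HasMeanValue.exists_le_of_isCompact {U : Set ℂ} {W : ℂ → ℝ} (hW : HasMeanValue U W)
    (hU : IsOpen U) {z₀ : ℂ} (hz₀ : z₀ ∈ U) {L : Set ℂ} (hL : IsCompact L) (hLU : L ⊆ U) :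
    ∃ z ∈ U \ L, W z ≤ W z₀ := by
  by_contra hcon
  push Not at hcon
  have hz₀L : z₀ ∈ L := by
    by_contra h
    exact lt_irrefl _ (hcon z₀ ⟨hz₀, h⟩)
  obtain ⟨x, hxL, hmin⟩ := hL.exists_isMinOn ⟨z₀, hz₀L⟩ (hW.1.mono hLU)
  have hle : ∀ z ∈ U, W x ≤ W z := by
    intro z hz
    by_cases h : z ∈ L
    · exact hmin h
    · exact (hmin hz₀L).trans (hcon z ⟨hz, h⟩).le
  have hM : IsCompact (L ∩ W ⁻¹' {W x}) :=
    hL.of_isClosed_subset ((hW.1.mono hLU).preimage_isClosed_of_isClosed hL.isClosed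
      isClosed_singleton) inter_subset_left
  obtain ⟨c, ⟨hcL, hcx⟩, hmax⟩ := hM.exists_isMaxOn ⟨x, hxL, rfl⟩
    Complex.continuous_re.continuousOn
  have hcx' : W c = W x := hcx
  obtain ⟨r, hr, hrU⟩ := Metric.nhds_basis_closedBall.mem_iff.1 (hU.mem_nhds (hLU hcL))
  have hcirc : ∀ t, circleMap c r t ∈ U := fun t =>
    hrU (Metric.sphere_subset_closedBall (circleMap_mem_sphere c hr.le t))
  have hlt : W c < W (circleMap c r 0) := by
    refine lt_of_le_of_ne (hcx' ▸ hle _ (hcirc 0)) fun h => ?_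
    by_cases hin : circleMap c r 0 ∈ L
    · have := hmax (show circleMap c r 0 ∈ L ∩ W ⁻¹' {W x} from ⟨hin, h.symm.trans hcx⟩)
      simp [circleMap] at this
      linarith
    · have h1 := hcon _ ⟨hcirc 0, hin⟩
      have h2 : W x ≤ W z₀ := hmin hz₀L
      linarith
  have := intervalIntegral.integral_lt_integral_of_continuousOn_of_le_of_exists_lt
    Real.two_pi_pos (continuousOn_const (c := W c))
    (hW.continuous_comp_circleMap hr hrU).continuousOn
    (fun t _ => hcx' ▸ hle _ (hcirc t)) ⟨0, ⟨le_rfl, Real.two_pi_pos.le⟩, hlt⟩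
  rw [hW.2 c r hr hrU] at this
  simp at this

/-- The logarithmic kernel `log |1 - s / w|`. -/
def logKernel (s w : ℂ) : ℝ := Real.log ‖w - s‖ - Real.log ‖w‖

lemma hasMeanValue_log_norm {U : Set ℂ} (hU : IsOpen U) {φ : ℂ → ℂ}
    (hφ : DifferentiableOn ℂ φ U) (h0 : ∀ z ∈ U, φ z ≠ 0) :
    HasMeanValue U fun z => Real.log ‖φ z‖ := by
  refine ⟨hφ.continuousOn.norm.log fun z hz => norm_ne_zero_iff.2 (h0 z hz), fun c r hr h => ?_⟩
  have := AnalyticOnNhd.circleAverage_log_norm_of_ne_zero (g := φ) (c := c) (R := r)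
    ((hφ.analyticOnNhd hU).mono (by rwa [abs_of_pos hr]))
    (fun u hu => h0 u (h (by rwa [abs_of_pos hr] at hu)))
  rw [Real.circleAverage, smul_eq_mul, inv_mul_eq_iff_eq_mul₀ Real.two_pi_pos.ne'] at this
  exact this

lemma hasMeanValue_logKernel {U : Set ℂ} (hU : IsOpen U) {φ : ℂ → ℂ}
    (hφ : DifferentiableOn ℂ φ U) (h0 : ∀ z ∈ U, φ z ≠ 0) {s : ℂ} (hs : ∀ z ∈ U, φ z ≠ s) :
    HasMeanValue U fun z => logKernel s (φ z) := by
  have h1 := hasMeanValue_log_norm hU (hφ.sub_const s) fun z hz => sub_ne_zero.2 (hs z hz)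
  have h2 := hasMeanValue_log_norm hU hφ h0
  refine ⟨h1.1.sub h2.1, fun c r hr h => ?_⟩
  simp only [logKernel]
  rw [intervalIntegral.integral_sub ((h1.continuous_comp_circleMap hr h).intervalIntegrable _ _)
    ((h2.continuous_comp_circleMap hr h).intervalIntegrable _ _), h1.2 c r hr h, h2.2 c r hr h]
  ring

open MeasureTheory in
lemma hasMeanValue_integral_logKernel {U : Set ℂ} (hU : IsOpen U) {φ : ℂ → ℂ}
    (hφ : DifferentiableOn ℂ φ U) (h0 : ∀ z ∈ U, φ z ≠ 0) {K : Set ℝ} (hK : IsCompact K)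
    {s : ℝ → ℂ} (hsc : Continuous s) (hs : ∀ z ∈ U, ∀ θ ∈ K, φ z ≠ s θ) :
    HasMeanValue U fun z => ∫ θ in K, logKernel (s θ) (φ z) := by
  have hcont : ContinuousOn (fun p : ℂ × ℝ => logKernel (s p.2) (φ p.1)) (U ×ˢ K) := by
    have hφ' : ContinuousOn (fun p : ℂ × ℝ => φ p.1) (U ×ˢ K) :=
      hφ.continuousOn.comp continuousOn_fst fun p hp => hp.1
    refine ContinuousOn.sub (ContinuousOn.log (hφ'.sub ?_).norm fun p hp => ?_)
      (hφ'.norm.log fun p hp => norm_ne_zero_iff.2 (h0 _ hp.1))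
    · exact (hsc.comp continuous_snd).continuousOn
    · exact norm_ne_zero_iff.2 (sub_ne_zero.2 (hs _ hp.1 _ hp.2))
  have hslice : ∀ z ∈ U, ContinuousOn (fun θ => logKernel (s θ) (φ z)) K := fun z hz =>
    hcont.comp (f := fun θ => (z, θ)) (by fun_prop) fun θ hθ => ⟨hz, hθ⟩
  refine ⟨fun z hz => ContinuousAt.continuousWithinAt ?_, fun c r hr h => ?_⟩
  · obtain ⟨r, hr, hrU⟩ := Metric.nhds_basis_closedBall.mem_iff.1 (hU.mem_nhds hz)
    obtain ⟨C, hC⟩ := ((isCompact_closedBall z r).prod hK).exists_bound_of_continuousOn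
      (hcont.mono (prod_mono hrU subset_rfl))
    refine continuousAt_of_dominated (bound := fun _ => C) ?_ ?_ ?_ ?_
    · filter_upwards [hU.mem_nhds hz] with y hy
      exact (hslice y hy).aestronglyMeasurable_of_isCompact hK hK.measurableSet
    · filter_upwards [Metric.closedBall_mem_nhds z hr] with y hy
      filter_upwards [ae_restrict_mem hK.measurableSet] with θ hθ
      exact hC (y, θ) ⟨hy, hθ⟩
    · exact integrableOn_const hK.measure_lt_top.ne
    · filter_upwards [ae_restrict_mem hK.measurableSet] with θ hθ
      exact (hasMeanValue_logKernel hU hφ h0 fun z hz => hs z hz θ hθ).1.continuousAt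
        (hU.mem_nhds hz)
  · have hcirc : ∀ t, circleMap c r t ∈ U := fun t =>
      h (Metric.sphere_subset_closedBall (circleMap_mem_sphere c hr.le t))
    have hintg : Integrable (uncurry fun t θ => logKernel (s θ) (φ (circleMap c r t)))
        ((volume.restrict (Ioc 0 (2 * Real.pi))).prod (volume.restrict K)) := by
      rw [Measure.prod_restrict]
      have hc2 : ContinuousOn (uncurry fun t θ => logKernel (s θ) (φ (circleMap c r t)))
          (Icc 0 (2 * Real.pi) ×ˢ K) :=
        hcont.comp (f := fun p : ℝ × ℝ => (circleMap c r p.1, p.2))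
          (((continuous_circleMap c r).comp continuous_fst).prodMk continuous_snd).continuousOn
          fun p hp => ⟨hcirc _, hp.2⟩
      exact (hc2.integrableOn_compact (isCompact_Icc.prod hK)).mono_set
        (prod_mono Ioc_subset_Icc_self subset_rfl)
    rw [intervalIntegral.integral_of_le Real.two_pi_pos.le, integral_integral_swap hintg,
      ← integral_const_mul]
    refine setIntegral_congr_fun hK.measurableSet fun θ hθ => ?_
    have := (hasMeanValue_logKernel hU hφ h0 fun z hz => hs z hz θ hθ).2 c r hr h
    rwa [intervalIntegral.integral_of_le Real.two_pi_pos.le] at this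

lemma logKernel_le {s w : ℂ} (hw : w ≠ 0) (hs : 1 ≤ ‖s‖) :
    logKernel s w ≤ Real.log 2 + Real.posLog (‖s‖ / ‖w‖) := by
  have hw' := norm_pos_iff.2 hw
  have hl2 : 0 ≤ Real.log 2 := Real.log_nonneg (by norm_num)
  have hp : 0 ≤ Real.posLog (‖s‖ / ‖w‖) := Real.posLog_nonneg
  rw [logKernel]
  by_cases h : w = s
  · subst h
    have := Real.log_nonneg hs
    rw [sub_self, norm_zero, Real.log_zero]
    linarith
  · rw [← Real.log_div (norm_ne_zero_iff.2 (sub_ne_zero.2 h)) hw'.ne']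
    have h1 : ‖w - s‖ / ‖w‖ ≤ 1 + ‖s‖ / ‖w‖ := by
      rw [div_le_iff₀ hw', add_mul, div_mul_cancel₀ _ hw'.ne', one_mul]
      exact norm_sub_le _ _
    have h2 : 0 < ‖w - s‖ / ‖w‖ := div_pos (norm_pos_iff.2 (sub_ne_zero.2 h)) hw'
    refine (Real.log_le_log h2 h1).trans ?_
    refine (le_max_right 0 _).trans ((Real.posLog_add (x := 1) (y := ‖s‖ / ‖w‖)).trans ?_)
    simp

lemma neg_logKernel_le {s w : ℂ} (hw : w ≠ 0) (hs : 2 * ‖s‖ ≤ ‖w‖) :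
    -logKernel s w ≤ Real.log 2 := by
  have hw' := norm_pos_iff.2 hw
  have h1 : ‖w‖ / 2 ≤ ‖w - s‖ := by
    have := norm_sub_norm_le w s
    linarith
  have h2 := Real.log_le_log (by positivity) h1
  rw [Real.log_div hw'.ne' (by norm_num)] at h2
  rw [logKernel]
  linarith

open MeasureTheory in
lemma integrableOn_logKernel (R : ℝ) (w : ℂ) :
    IntegrableOn (fun θ => logKernel (circleMap 0 R θ) w) (Icc 0 (2 * Real.pi)) := by
  rw [integrableOn_Icc_iff_integrableOn_Ioc]
  have h := circleIntegrable_log_norm_sub_const (c := 0) (a := w) R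
  have h2 := (intervalIntegrable_iff_integrableOn_Ioc_of_le Real.two_pi_pos.le).1 h
  refine (h2.sub (integrableOn_const (C := Real.log ‖w‖) measure_Ioc_lt_top.ne)).congr_fun
    ?_ measurableSet_Ioc
  intro θ _
  simp [logKernel, norm_sub_rev]

open MeasureTheory in
lemma integral_logKernel {R : ℝ} (hR : 0 < R) {w : ℂ} (hw : w ≠ 0) :
    ∫ θ in Ioc 0 (2 * Real.pi), logKernel (circleMap 0 R θ) w =
      2 * Real.pi * Real.posLog (R / ‖w‖) := by
  have h := circleIntegrable_log_norm_sub_const (c := 0) (a := w) R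
  have h2 := (intervalIntegrable_iff_integrableOn_Ioc_of_le Real.two_pi_pos.le).1 h
  have h3 := circleAverage_log_norm_sub_const_eq_log_radius_add_posLog (c := 0) (a := w) hR.ne'
  rw [Real.circleAverage, smul_eq_mul, inv_mul_eq_iff_eq_mul₀ Real.two_pi_pos.ne',
    intervalIntegral.integral_of_le Real.two_pi_pos.le] at h3
  simp only [logKernel, norm_sub_rev w]
  rw [integral_sub h2 (integrableOn_const measure_Ioc_lt_top.ne), h3, setIntegral_const]
  have h4 := Real.posLog_sub_posLog_inv (x := R / ‖w‖)
  rw [Real.log_div hR.ne' (norm_ne_zero_iff.2 hw), inv_div] at h4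
  rw [zero_sub, norm_neg, inv_mul_eq_div]
  simp [Real.pi_pos.le]
  linear_combination -2 * Real.pi * h4

open MeasureTheory in
/-- The logarithmic potential of the part of a circle outside a set `E`, normalised to be
nonnegative. -/
def circlePotential (R : ℝ) (E : Set ℝ) (w : ℂ) : ℝ :=
  (∫ θ in Icc 0 (2 * Real.pi) \ E, logKernel (circleMap 0 R θ) w) +
    volume.real (Icc 0 (2 * Real.pi) ∩ E) * Real.log 2

open MeasureTheory in
lemma circlePotential_eq {R : ℝ} (hR : 0 < R) {E : Set ℝ} (hE : MeasurableSet E) {w : ℂ}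
    (hw : w ≠ 0) : circlePotential R E w = 2 * Real.pi * Real.posLog (R / ‖w‖) -
      (∫ θ in Icc 0 (2 * Real.pi) ∩ E, logKernel (circleMap 0 R θ) w) +
      volume.real (Icc 0 (2 * Real.pi) ∩ E) * Real.log 2 := by
  rw [circlePotential, ← integral_logKernel hR hw, ← integral_Icc_eq_integral_Ioc,
    ← integral_inter_add_sdiff hE (integrableOn_logKernel R w)]
  ring

open MeasureTheory in
lemma le_circlePotential {R : ℝ} (hR : 1 ≤ R) {E : Set ℝ} (hE : MeasurableSet E) {w : ℂ}
    (hw : w ≠ 0) : (2 * Real.pi - volume.real (Icc 0 (2 * Real.pi) ∩ E)) *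
      Real.posLog (R / ‖w‖) ≤ circlePotential R E w := by
  have hI : volume (Icc 0 (2 * Real.pi) ∩ E) < ⊤ :=
    (measure_mono inter_subset_left).trans_lt isCompact_Icc.measure_lt_top
  have hintg := (integrableOn_logKernel R w).mono_set (inter_subset_left (t := E))
  have h1 := setIntegral_mono_on hintg (integrableOn_const
    (C := Real.log 2 + Real.posLog (R / ‖w‖)) hI.ne) (measurableSet_Icc.inter hE)
    (fun θ _ => by
      have := logKernel_le (s := circleMap 0 R θ) hw (by simpa using hR.trans (le_abs_self R))
      rwa [norm_circleMap_zero, abs_of_pos (by linarith)] at this)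
  rw [setIntegral_const, smul_eq_mul] at h1
  rw [circlePotential_eq (by linarith) hE hw]
  linarith

open MeasureTheory in
lemma circlePotential_le {R : ℝ} (hR : 0 < R) {E : Set ℝ} (hE : MeasurableSet E) {w : ℂ}
    (hw : w ≠ 0) (hRw : 2 * R ≤ ‖w‖) :
    circlePotential R E w ≤ 2 * volume.real (Icc 0 (2 * Real.pi) ∩ E) := by
  have hI : volume (Icc 0 (2 * Real.pi) ∩ E) < ⊤ :=
    (measure_mono inter_subset_left).trans_lt isCompact_Icc.measure_lt_top
  have hintg := (integrableOn_logKernel R w).mono_set (inter_subset_left (t := E))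
  have h1 := setIntegral_mono_on (integrableOn_const (C := -Real.log 2) hI.ne) hintg
    (measurableSet_Icc.inter hE) (fun θ _ => by
      have := neg_logKernel_le (s := circleMap 0 R θ) hw (by simpa [abs_of_pos hR] using hRw)
      linarith)
  rw [setIntegral_const, smul_eq_mul] at h1
  have h2 : Real.posLog (R / ‖w‖) = 0 := by
    rw [Real.posLog_eq_zero_iff, abs_of_nonneg (by positivity),
      div_le_one (norm_pos_iff.2 hw)]
    linarith
  have h3 : Real.log 2 ≤ 1 := by linarith [Real.log_two_lt_d9]
  have h4 : 0 ≤ volume.real (Icc 0 (2 * Real.pi) ∩ E) := measureReal_nonneg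
  rw [circlePotential_eq hR hE hw, h2]
  nlinarith

open MeasureTheory in
/-- For pairwise disjoint open sets, the angular measures of their traces (and of the traces of
their inversions) on a circle are summable. -/
lemma tsum_volume_circle_ne_top {V : ℕ → Set ℂ} (hV : ∀ k, IsOpen (V k))
    (hd : Pairwise fun j k => Disjoint (V j) (V k)) {s : ℝ → ℂ} (hs : Continuous s) :
    ∑' k, volume (Icc 0 (2 * Real.pi) ∩ s ⁻¹' V k) ≠ ⊤ := by
  have hm : ∀ k, MeasurableSet (Icc 0 (2 * Real.pi) ∩ s ⁻¹' V k) := fun k =>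
    measurableSet_Icc.inter ((hV k).preimage hs).measurableSet
  rw [← measure_iUnion (fun j k hjk => ((hd hjk).preimage s).mono inter_subset_right
    inter_subset_right) hm, ← inter_iUnion]
  exact ((measure_mono inter_subset_left).trans_lt isCompact_Icc.measure_lt_top).ne

open MeasureTheory in
/-- If a sequence of nonvanishing holomorphic functions has pairwise disjoint images of a bounded
open set `U` and escapes at some point of `U`, then it escapes at some boundary point of `U`. -/
theorem exists_frontier_escaping {N U : Set ℂ} (hN : IsOpen N) (hU : IsOpen U)
    (hcl : IsCompact (closure U)) (hUN : closure U ⊆ N) {F : ℕ → ℂ → ℂ}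
    (hF : ∀ k, DifferentiableOn ℂ (F k) N) (h0 : ∀ k, ∀ z ∈ N, F k z ≠ 0)
    (hopen : ∀ k, IsOpen (F k '' U))
    (hd : Pairwise fun j k => Disjoint (F j '' U) (F k '' U)) {z₀ : ℂ} (hz₀ : z₀ ∈ U)
    (hesc : Tendsto (fun k => |Real.log ‖F k z₀‖|) atTop atTop) :
    ∃ ζ ∈ frontier U, ∀ ρ : ℝ, ∀ᶠ k in atTop, ρ < |Real.log ‖F k ζ‖| := by
  by_contra hcon
  push Not at hcon
  have hU' : U ⊆ N := subset_closure.trans hUN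
  -- normalise so that the orbit of `z₀` tends to infinity
  set φ : ℕ → ℂ → ℂ := fun k => if 0 ≤ Real.log ‖F k z₀‖ then F k else fun z => (F k z)⁻¹ with hφ
  have hφd : ∀ k, DifferentiableOn ℂ (φ k) N := by
    intro k
    simp only [hφ]
    split_ifs
    · exact hF k
    · exact (hF k).inv (h0 k)
  have hφ0 : ∀ k, ∀ z ∈ N, φ k z ≠ 0 := by
    intro k z hz
    simp only [hφ]
    split_ifs
    · exact h0 k z hz
    · exact inv_ne_zero (h0 k z hz)
  have hφle : ∀ k z, Real.log ‖φ k z‖ ≤ |Real.log ‖F k z‖| := by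
    intro k z
    simp only [hφ]
    split_ifs
    · exact le_abs_self _
    · rw [norm_inv, Real.log_inv]
      exact neg_le_abs _
  have hφz₀ : ∀ k, Real.log ‖φ k z₀‖ = |Real.log ‖F k z₀‖| := by
    intro k
    simp only [hφ]
    split_ifs with h
    · rw [abs_of_nonneg h]
    · rw [norm_inv, Real.log_inv, abs_of_neg (not_le.1 h)]
  set s : ℕ → ℝ → ℂ := fun m => circleMap 0 (Real.exp m) with hs
  have hsc : ∀ m, Continuous (s m) := fun m => continuous_circleMap _ _
  have hs0 : ∀ m θ, s m θ ≠ 0 := fun m θ => by simp [hs, circleMap]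
  set E : ℕ → ℕ → Set ℝ := fun m k => s m ⁻¹' (φ k '' U) with hE
  have hEor : ∀ m k, E m k ⊆ s m ⁻¹' (F k '' U) ∪ (fun θ => (s m θ)⁻¹) ⁻¹' (F k '' U) := by
    rintro m k θ ⟨z, hz, hzθ⟩
    simp only [hφ] at hzθ
    split_ifs at hzθ
    · exact Or.inl ⟨z, hz, hzθ⟩
    · exact Or.inr ⟨z, hz, inv_eq_iff_eq_inv.1 hzθ⟩
  have hEopen : ∀ m k, IsOpen (E m k) := by
    intro m k
    by_cases h : 0 ≤ Real.log ‖F k z₀‖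
    · simp only [hE, hφ, if_pos h]
      exact (hopen k).preimage (hsc m)
    · have : E m k = (fun θ => (s m θ)⁻¹) ⁻¹' (F k '' U) := by
        ext θ
        simp only [hE, hφ, if_neg h, mem_preimage, mem_image]
        exact exists_congr fun z => and_congr_right fun _ => inv_eq_iff_eq_inv
      rw [this]
      exact (hopen k).preimage ((hsc m).inv₀ (hs0 m))
  set α : ℕ → ℕ → ENNReal := fun m k => volume (Icc 0 (2 * Real.pi) ∩ E m k) with hα
  have hsum : ∀ m, ∑' k, α m k ≠ ⊤ := by
    intro m
    have h1 := tsum_volume_circle_ne_top hopen hd (hsc m)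
    have h2 := tsum_volume_circle_ne_top hopen hd ((hsc m).inv₀ (hs0 m))
    refine ne_top_of_le_ne_top (ENNReal.add_ne_top.2 ⟨h1, h2⟩) ?_
    rw [← ENNReal.tsum_add]
    refine ENNReal.tsum_le_tsum fun k => ?_
    refine (measure_mono (inter_subset_inter_right _ (hEor m k))).trans ?_
    rw [inter_union_distrib_left]
    exact measure_union_le _ _
  obtain ⟨ε, hε, hεsum⟩ := ENNReal.exists_pos_sum_of_countable
    (ε := ENNReal.ofReal (1 / 4)) (by simp) ℕ
  have hKex : ∀ m : ℕ, ∃ K : ℕ, ∑' j, α m (j + K) ≤ ε m ∧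
      ∀ k ≥ K, (m + 1 : ℝ) ≤ |Real.log ‖F k z₀‖| := by
    intro m
    have e1 := (ENNReal.tendsto_sum_nat_add _ (hsum m)).eventually
      (gt_mem_nhds (show (0 : ENNReal) < ε m by exact_mod_cast hε m))
    have e2 := eventually_forall_ge_atTop.2 (hesc.eventually_ge_atTop (m + 1 : ℝ))
    obtain ⟨K, hK1, hK2⟩ := (e1.and e2).exists
    exact ⟨K, hK1.le, hK2⟩
  choose K hK1 hK2 using hKex
  have htot : ∀ S : Finset (ℕ × ℕ), ∑ p ∈ S, (α p.1 (p.2 + K p.1)).toReal ≤ 1 / 4 := by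
    intro S
    have hle : ∑ p ∈ S, α p.1 (p.2 + K p.1) ≤ ENNReal.ofReal (1 / 4) := by
      refine (ENNReal.sum_le_tsum S).trans ?_
      rw [ENNReal.tsum_prod']
      exact (ENNReal.tsum_le_tsum hK1).trans hεsum.le
    rw [← ENNReal.toReal_sum fun p _ => ENNReal.ne_top_of_tsum_ne_top
      (hsum p.1) _]
    exact ENNReal.toReal_le_of_le_ofReal (by norm_num) hle
  -- near the boundary some potential is at least one
  set O : ℕ × ℕ → Set ℂ := fun p => {z ∈ N | Real.log ‖φ (p.2 + K p.1) z‖ < p.1 - 1} with hO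
  have hOopen : ∀ p, IsOpen (O p) := fun p =>
    ((hφd _).continuousOn.norm.log fun z hz => norm_ne_zero_iff.2
      (hφ0 _ z hz)).isOpen_inter_preimage hN isOpen_Iio
  have hcover : frontier U ⊆ ⋃ p, O p := by
    intro ζ hζ
    obtain ⟨ρ, hρ⟩ := hcon ζ hζ
    obtain ⟨m, hm⟩ := exists_nat_gt (ρ + 1)
    obtain ⟨k, hk, hkρ⟩ := (frequently_atTop.1 hρ) (K m)
    refine mem_iUnion.2 ⟨(m, k - K m), hUN (frontier_subset_closure hζ), ?_⟩
    rw [Nat.sub_add_cancel hk]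
    have := hφle k ζ
    simp only
    linarith
  obtain ⟨S, hS⟩ := (hcl.of_isClosed_subset isClosed_frontier
    frontier_subset_closure).elim_finite_subcover O hOopen hcover
  set v : ℕ × ℕ → ℂ → ℝ := fun p z =>
    circlePotential (Real.exp p.1) (E p.1 (p.2 + K p.1)) (φ (p.2 + K p.1) z) with hv
  have hα' : ∀ p : ℕ × ℕ, volume.real (Icc 0 (2 * Real.pi) ∩ E p.1 (p.2 + K p.1)) ≤ 1 / 4 := by
    intro p
    simpa using! htot {p}
  have hmv : HasMeanValue U fun z => ∑ p ∈ S, v p z := by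
    refine HasMeanValue.sum S fun p _ => HasMeanValue.add_const ?_ _
    refine hasMeanValue_integral_logKernel hU ((hφd _).mono hU') (fun z hz => hφ0 _ z (hU' hz))
      (isCompact_Icc.diff (hEopen _ _)) (hsc p.1) fun z hz θ hθ h => hθ.2 ⟨z, hz, h⟩
  have hpi := Real.pi_gt_three
  have hlow : ∀ p, ∀ z ∈ U, Real.posLog (Real.exp p.1 / ‖φ (p.2 + K p.1) z‖) ≤ v p z := by
    intro p z hz
    refine le_trans ?_ (le_circlePotential (Real.one_le_exp (by positivity))
      (hEopen _ _).measurableSet (hφ0 _ z (hU' hz)))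
    refine le_mul_of_one_le_left Real.posLog_nonneg ?_
    linarith [hα' p]
  have hupp : ∑ p ∈ S, v p z₀ ≤ 1 / 2 := by
    have : ∑ p ∈ S, v p z₀ ≤ ∑ p ∈ S, 2 * (α p.1 (p.2 + K p.1)).toReal := by
      refine Finset.sum_le_sum fun p _ => ?_
      refine circlePotential_le (Real.exp_pos _) (hEopen _ _).measurableSet
        (hφ0 _ z₀ (hU' hz₀)) ?_
      have h1 := hK2 p.1 (p.2 + K p.1) (by omega)
      rw [← hφz₀, Real.le_log_iff_exp_le (norm_pos_iff.2 (hφ0 _ z₀ (hU' hz₀))),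
        Real.exp_add] at h1
      refine le_trans ?_ h1
      rw [mul_comm]
      gcongr
      linarith [Real.exp_one_gt_d9]
    rw [← Finset.mul_sum] at this
    linarith [htot S]
  obtain ⟨z, ⟨hzU, hzL⟩, hz⟩ := hmv.exists_le_of_isCompact hU hz₀
    (hcl.diff (isOpen_biUnion fun p (_ : p ∈ S) => hOopen p)) (by
      rintro z ⟨hz, hzn⟩
      by_contra hzU
      exact hzn (hS ⟨hz, by rwa [hU.interior_eq]⟩))
  have hzO : z ∈ ⋃ p ∈ S, O p := by
    by_contra h
    exact hzL ⟨subset_closure hzU, h⟩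
  simp only [mem_iUnion, exists_prop] at hzO
  obtain ⟨p, hpS, hzN, hzlt⟩ := hzO
  have h1 : 1 ≤ v p z := by
    refine le_trans ?_ (hlow p z hzU)
    refine le_trans ?_ (le_max_right _ _)
    rw [Real.log_div (Real.exp_pos _).ne' (norm_ne_zero_iff.2 (hφ0 _ z hzN)), Real.log_exp]
    linarith
  have h2 : v p z ≤ ∑ p ∈ S, v p z := Finset.single_le_sum
    (fun q _ => Real.posLog_nonneg.trans (hlow q z hzU)) hpS
  linarith

/-- A bounded domain in the punctured plane which meets the escaping set has an escaping
boundary point. -/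
theorem IsExpanding.frontier_inter_escapingSet_nonempty {f : ℂ → ℂ} {ρ₀ : ℝ}
    (hf : IsExpanding f ρ₀) {U : Set ℂ} (hU : IsOpen U) (hconn : IsPreconnected U)
    (hcl : IsCompact (closure U)) (h0 : 0 ∉ closure U) (hne : (U ∩ escapingSet f).Nonempty) :
    (frontier U ∩ escapingSet f).Nonempty := by
  by_contra hcon
  have hI : Disjoint (frontier U) (escapingSet f) := by
    rwa [Set.disjoint_iff_inter_eq_empty, ← not_nonempty_iff_eq_empty]
  have hUI := hf.subset_escapingSet hU hconn hcl h0 hI hne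
  have hcl0 : closure U ⊆ {0}ᶜ := fun z hz h => h0 (h ▸ hz)
  obtain ⟨z₀, hz₀, hz₀I⟩ := hne
  have hdis := fun {j k : ℕ} (h : j < k) => hf.disjoint_iterate_image hU hconn hcl h0 hI hUI h
  obtain ⟨ζ, hζ, hζe⟩ := exists_frontier_escaping isOpen_compl_singleton hU hcl hcl0
    hf.iterate_differentiableOn (fun k z hz => hf.iterate_ne_zero k hz)
    (fun k => hf.iterate_isOpen_image k hU fun h => h0 (subset_closure h))
    (fun j k hjk => (lt_or_gt_of_ne hjk).elim hdis fun h => (hdis h).symm) hz₀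
    (tendsto_atTop.2 fun ρ => ((hf.mem_escapingSet_iff.1 hz₀I).2 ρ).mono fun _ h => h.le)
  exact hI.notMem_of_mem_left hζ
    (hf.mem_escapingSet_iff.2 ⟨hcl0 (frontier_subset_closure hζ), hζe⟩)

/-! ### Separations of the escaping set -/

/-- A relatively clopen nonempty part of the escaping set cannot stay away from both `0` and
`∞`. -/
theorem IsExpanding.not_separated {f : ℂ → ℂ} {ρ₀ : ℝ} (hf : IsExpanding f ρ₀) {u v : Set ℂ}
    (hu : IsOpen u) (hcover : escapingSet f ⊆ u ∪ v)
    (hdisj : Disjoint (escapingSet f ∩ u) v) (hne : (escapingSet f ∩ u).Nonempty)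
    (h0 : (0 : ℂ) ∈ v) (hvc : IsCompact vᶜ) : False := by
  set A := escapingSet f ∩ u with hA
  obtain ⟨L, hL, hvL, hL0⟩ := exists_compact_between hvc isOpen_compl_singleton
    (show vᶜ ⊆ {(0 : ℂ)}ᶜ from compl_subset_compl.2 (singleton_subset_iff.2 h0))
  have hAv : A ⊆ vᶜ := fun z hz hzv => hdisj.le_bot ⟨hz, hzv⟩
  set B := escapingSet f ∩ v ∪ (interior L)ᶜ with hB
  have hBv : B ⊆ v := union_subset inter_subset_right (compl_subset_comm.1 hvL)
  have hAB : Disjoint (closure A) B :=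
    disjoint_left.2 fun z hz hzB => closure_minimal hAv hvc.isClosed hz (hBv hzB)
  have hAB' : Disjoint A (closure B) := by
    rw [hB, closure_union, isOpen_interior.isClosed_compl.closure_eq, disjoint_union_right]
    refine ⟨?_, disjoint_left.2 fun z hz hzL => hzL (hvL (hAv hz))⟩
    refine (Disjoint.closure_right ?_ hu).mono_left inter_subset_right
    exact disjoint_left.2 fun z hzu hz => hdisj.le_bot ⟨⟨hz.1, hzu⟩, hz.2⟩
  obtain ⟨V, W, hV, hW, hAV, hBW, hVW⟩ :=
    separatedNhds_iff_disjoint.2 (CompletelyNormalSpace.completely_normal hAB hAB')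
  have hVL : closure V ⊆ L := closure_minimal (fun z hz => interior_subset <| by
    by_contra h
    exact hVW.le_bot ⟨hz, hBW (Or.inr h)⟩) hL.isClosed
  obtain ⟨a, ha⟩ := hne
  set U := connectedComponentIn V a with hUdef
  have hU : IsOpen U := hV.connectedComponentIn
  have hUV : closure U ⊆ closure V := closure_mono (connectedComponentIn_subset V a)
  obtain ⟨w, hwU, hwI⟩ := hf.frontier_inter_escapingSet_nonempty hU
    isPreconnected_connectedComponentIn (hL.of_isClosed_subset isClosed_closure (hUV.trans hVL))
    (fun h => hL0 (hVL (hUV h)) rfl) ⟨a, mem_connectedComponentIn (hAV ha), ha.1⟩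
  have hwcl := frontier_subset_closure hwU
  rcases hcover hwI with hwu | hwv
  · have hwV : w ∈ V := hAV ⟨hwI, hwu⟩
    obtain ⟨y, hyw, hyU⟩ := mem_closure_iff.1 hwcl _ (hV.connectedComponentIn (x := w))
      (mem_connectedComponentIn hwV)
    have hwU' : w ∈ U := by
      rw [hUdef, connectedComponentIn_eq hyU, ← connectedComponentIn_eq hyw]
      exact mem_connectedComponentIn hwV
    rw [hU.frontier_eq] at hwU
    exact hwU.2 hwU'
  · exact (hVW.closure_left hW).le_bot ⟨hUV hwcl, hBW (Or.inl ⟨hwI, hwv⟩)⟩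

theorem coe_mem_escapingSphere {f : ℂ → ℂ} {z : ℂ} (hz : z ∈ escapingSet f) :
    (z : OnePoint ℂ) ∈ escapingSphere f :=
  Or.inl ⟨z, hz, rfl⟩

theorem zero_mem_escapingSphere (f : ℂ → ℂ) : ((0 : ℂ) : OnePoint ℂ) ∈ escapingSphere f :=
  Or.inr (Or.inl rfl)

theorem infty_mem_escapingSphere (f : ℂ → ℂ) : ∞ ∈ escapingSphere f :=
  Or.inr (Or.inr rfl)

/-- A separation of the escaping set on the sphere separates `0` from `∞`. -/
theorem IsExpanding.not_separated_sphere {f : ℂ → ℂ} {ρ₀ : ℝ} (hf : IsExpanding f ρ₀)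
    {u v : Set (OnePoint ℂ)} (hu : IsOpen u) (hv : IsOpen v) (hcover : escapingSphere f ⊆ u ∪ v)
    (hdisj : ¬ (escapingSphere f ∩ (u ∩ v)).Nonempty) (hne : (escapingSphere f ∩ u).Nonempty)
    (h0 : ((0 : ℂ) : OnePoint ℂ) ∈ v) (hinf : ∞ ∈ v) : False := by
  refine hf.not_separated (u := ((↑) : ℂ → OnePoint ℂ) ⁻¹' u)
    (v := ((↑) : ℂ → OnePoint ℂ) ⁻¹' v) (hu.preimage continuous_coe)
    (fun z hz => hcover (coe_mem_escapingSphere hz))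
    (disjoint_left.2 fun z hz hzv => hdisj ⟨z, coe_mem_escapingSphere hz.1, hz.2, hzv⟩)
    ?_ h0 ((isOpen_iff_of_mem hinf).1 hv).2
  obtain ⟨x, ⟨z, hz, rfl⟩ | rfl | rfl, hxu⟩ := hne
  · exact ⟨z, hz, hxu⟩
  · exact absurd ⟨_, zero_mem_escapingSphere f, hxu, h0⟩ hdisj
  · exact absurd ⟨_, infty_mem_escapingSphere f, hxu, hinf⟩ hdisj

/-- A set `K` all of whose separations separate `a` from `b` is, for any such separation,
preconnected on each side. -/
theorem isPreconnected_inter_of_forall_separation {X : Type*} [TopologicalSpace X] {K u v : Set X}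
    {a b : X} (hS : ∀ u v : Set X, IsOpen u → IsOpen v → K ⊆ u ∪ v → ¬ (K ∩ (u ∩ v)).Nonempty →
      (K ∩ u).Nonempty → a ∈ v → b ∈ v → False)
    (haK : a ∈ K) (hu : IsOpen u) (hv : IsOpen v) (hcover : K ⊆ u ∪ v)
    (hdisj : ¬ (K ∩ (u ∩ v)).Nonempty) (ha : a ∈ u) (hb : b ∈ v) : IsPreconnected (K ∩ u) := by
  have key : ∀ p q : Set X, IsOpen p → IsOpen q → K ∩ u ⊆ p ∪ q → (K ∩ u ∩ q).Nonempty →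
      a ∈ p → (K ∩ u ∩ (p ∩ q)).Nonempty := by
    intro p q hp hq hpq hne hap
    by_contra hcon
    refine hS (u ∩ q) (v ∪ u ∩ p) (hu.inter hq) (hv.union (hu.inter hp)) ?_ ?_ ?_
      (Or.inr ⟨ha, hap⟩) (Or.inl hb)
    · intro x hx
      rcases hcover hx with hxu | hxv
      · rcases hpq ⟨hx, hxu⟩ with hxp | hxq
        · exact Or.inr (Or.inr ⟨hxu, hxp⟩)
        · exact Or.inl ⟨hxu, hxq⟩
      · exact Or.inr (Or.inl hxv)
    · rintro ⟨x, hx, ⟨hxu, hxq⟩, hxv | ⟨-, hxp⟩⟩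
      · exact hdisj ⟨x, hx, hxu, hxv⟩
      · exact hcon ⟨x, ⟨hx, hxu⟩, hxp, hxq⟩
    · rwa [← inter_assoc]
  intro p q hp hq hpq hnp hnq
  rcases hpq ⟨haK, ha⟩ with hap | haq
  · exact key p q hp hq hpq hnq hap
  · rw [inter_comm p q]
    exact key q p hq hp (by rwa [union_comm]) hnp haq

/-- If all separations of `K` separate `a` from `b`, then `K` is preconnected or consists of two
components, one containing `a` and the other containing `b`. -/
theorem isPreconnected_or_two_components {X : Type*} [TopologicalSpace X] {K : Set X} {a b : X}
    (hS : ∀ u v : Set X, IsOpen u → IsOpen v → K ⊆ u ∪ v → ¬ (K ∩ (u ∩ v)).Nonempty →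
      (K ∩ u).Nonempty → a ∈ v → b ∈ v → False) (ha : a ∈ K) (hb : b ∈ K) :
    IsPreconnected K ∨ (connectedComponentIn K a ≠ connectedComponentIn K b ∧
      connectedComponentIn K a ∪ connectedComponentIn K b = K) := by
  have key : ∀ u v : Set X, IsOpen u → IsOpen v → K ⊆ u ∪ v → ¬ (K ∩ (u ∩ v)).Nonempty →
      a ∈ u → b ∈ v → connectedComponentIn K a ≠ connectedComponentIn K b ∧
      connectedComponentIn K a ∪ connectedComponentIn K b = K := by
    intro u v hu hv hcover hdisj hau hbv
    have hcover' : K ⊆ v ∪ u := by rwa [union_comm]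
    have hdisj' : ¬ (K ∩ (v ∩ u)).Nonempty := by rwa [inter_comm v u]
    have hKu := isPreconnected_inter_of_forall_separation hS ha hu hv hcover hdisj hau hbv
    have hKv := isPreconnected_inter_of_forall_separation
      (fun u v hu hv h1 h2 h3 h4 h5 => hS u v hu hv h1 h2 h3 h5 h4) hb hv hu hcover' hdisj' hbv hau
    constructor
    · intro h
      have hsub := connectedComponentIn_subset K a
      obtain ⟨x, hx, hxuv⟩ := isPreconnected_connectedComponentIn u v hu hv (hsub.trans hcover)
        ⟨a, mem_connectedComponentIn ha, hau⟩ ⟨b, h ▸ mem_connectedComponentIn hb, hbv⟩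
      exact hdisj ⟨x, hsub hx, hxuv⟩
    · refine (union_subset (connectedComponentIn_subset K a)
        (connectedComponentIn_subset K b)).antisymm fun x hx => ?_
      rcases hcover hx with hxu | hxv
      · exact Or.inl (hKu.subset_connectedComponentIn ⟨ha, hau⟩ inter_subset_left ⟨hx, hxu⟩)
      · exact Or.inr (hKv.subset_connectedComponentIn ⟨hb, hbv⟩ inter_subset_left ⟨hx, hxv⟩)
  refine or_iff_not_imp_left.2 fun hK => ?_
  simp only [IsPreconnected, not_forall] at hK
  obtain ⟨u, v, hu, hv, hcover, hnu, hnv, hdisj⟩ := hK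
  have hcover' : K ⊆ v ∪ u := by rwa [union_comm]
  have hdisj' : ¬ (K ∩ (v ∩ u)).Nonempty := by rwa [inter_comm v u]
  rcases hcover ha with hau | hav <;> rcases hcover hb with hbu | hbv
  · exact (hS v u hv hu hcover' hdisj' hnv hau hbu).elim
  · exact key u v hu hv hcover hdisj hau hbv
  · exact key v u hv hu hcover' hdisj' hav hbu
  · exact (hS u v hu hv hcover hdisj hnu hav hbv).elim

/-- For a transcendental self-map `f` of `ℂ*`, the set `I(f) ∪ {0,∞} ⊆ ℂ̂`
is either connected, or has exactly two connected components, one containing `0` and the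
other containing `∞`. -/
theorem escapingSphere_connected_or_two_components (f : ℂ → ℂ)
    (hf : IsTranscendentalSelfMapCStar f) :
    IsConnected (escapingSphere f) ∨
      (connectedComponentIn (escapingSphere f) ((0 : ℂ) : OnePoint ℂ) ≠
          connectedComponentIn (escapingSphere f) ∞ ∧
        connectedComponentIn (escapingSphere f) ((0 : ℂ) : OnePoint ℂ) ∪
            connectedComponentIn (escapingSphere f) ∞ = escapingSphere f) := by
  obtain ⟨ρ₀, hpos, hcov⟩ := hf.exists_logAnnulus_subset_image
  have hexp : IsExpanding f ρ₀ := ⟨hf.differentiableOn, fun z hz => hf.ne_zero hz, hpos, hcov⟩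
  exact (isPreconnected_or_two_components
    (fun u v hu hv hcover hdisj hne h0 hinf =>
      hexp.not_separated_sphere hu hv hcover hdisj hne h0 hinf)
    (zero_mem_escapingSphere f) (infty_mem_escapingSphere f)).imp_left
    fun h => ⟨⟨_, zero_mem_escapingSphere f⟩, h⟩
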